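/- For every (ν,J) ∈ RC(∞) and every a ∈ I, let x ≤ 0 be the smallest rigging occurring in ν^(a) (including the riggings 0 of the length-0 rows). Then ε_a(ν,J) = -x and φ_a(ν,J) = p_∞^(a) - x. -/

import Mathlib

/-! Rigged configurations for generalized Kac–Moody (Borcherds) algebras. -/

/-- A Borcherds–Cartan matrix: integer matrix with `A a a = 2` or `A a a` nonpositive even,
nonpositive off-diagonal entries, and `A a b = 0 ↔ A b a = 0`. -/
structure IsBorcherdsCartan {I : Type*} (A : I → I → ℤ) : Prop where
  diag : ∀ a, A a a = 2 ∨ (A a a ≤ 0 ∧ Even (A a a))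
  offdiag : ∀ a b, a ≠ b → A a b ≤ 0
  zero_iff : ∀ a b, A a b = 0 ↔ A b a = 0

/-- A (raw) rigged configuration: for each color `a ∈ I`, a multiset of pairs
`(row length, rigging)`.  Rows of length `0` with rigging `0` are treated implicitly by the
operators below. -/
abbrev RCraw (I : Type*) := I → Multiset (ℕ × ℤ)

variable {I : Type*} [DecidableEq I]

/-- The empty rigged configuration `(ν_∅, J_∅)`. -/
def emptyRC : RCraw I := fun _ => 0

/-- `|ν^(b)|`, the number of boxes of color `b`. -/
def rcSize (ν : RCraw I) (b : I) : ℤ := ((ν b).map fun p => (p.1 : ℤ)).sum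

/-- The vacancy number `p_i^(a) = -∑_b A a b ∑_{rows j of ν^(b)} min i j`. -/
noncomputable def vac (A : I → I → ℤ) (ν : RCraw I) (a : I) (i : ℕ) : ℤ :=
  -∑ᶠ b, A a b * ((ν b).map fun p => (min i p.1 : ℤ)).sum

/-- The limiting vacancy number `p_∞^(a) = -∑_b A a b |ν^(b)| = ⟨h_a, wt(ν,J)⟩`. -/
noncomputable def pInf (A : I → I → ℤ) (ν : RCraw I) (a : I) : ℤ :=
  -∑ᶠ b, A a b * rcSize ν b

/-- Minimum of a multiset of integers together with `0` (the rigging of the implicit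
length-`0` rows). -/
def minWith0 (s : Multiset ℤ) : ℤ := s.fold min 0

/-- Minimum of a nonempty multiset of integers (junk value `0` on the empty multiset). -/
def minPosRows (s : Multiset ℤ) : ℤ := s.fold min (s.fold max 0)

/-- Maximum of a multiset of naturals together with `0`. -/
def maxWith0 (s : Multiset ℕ) : ℕ := s.fold max 0

/-- Minimum of a nonempty multiset of naturals (junk value on the empty multiset). -/
def minPosRowsN (s : Multiset ℕ) : ℕ := s.fold min (s.fold max 0)

/-- The crystal operator `f_a` on rigged configurations: add a box to a row of maximal
length among the rows of `ν^(a)` whose rigging equals the smallest rigging `x` (with the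
length-`0` rows of rigging `0` included), give the new row the rigging `x - A a a / 2`, and
change all other riggings so that the coriggings are preserved. -/
def fOp (A : I → I → ℤ) (a : I) (ν : RCraw I) : RCraw I :=
  let M := ν a
  let x := minWith0 (M.map Prod.snd)
  let ℓ := maxWith0 ((M.filter fun p => p.2 = x).map Prod.fst)
  fun b =>
    let adj : Multiset (ℕ × ℤ) → Multiset (ℕ × ℤ) :=
      Multiset.map fun p => (p.1, p.2 - if ℓ < p.1 then A b a else 0)
    if b = a then adj (M.erase (ℓ, x)) + {(ℓ + 1, x - A a a / 2)} else adj (ν b)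

/-- Auxiliary for `eOp`: remove a box from a row of minimal (positive) length among the
rows of `ν^(a)` with rigging `x`, give it the rigging `x + A a a / 2` (dropping the row if
its length becomes `0`), and change all other riggings so that the coriggings are
preserved. -/
def eRemove (A : I → I → ℤ) (a : I) (ν : RCraw I) (x : ℤ) : RCraw I :=
  let M := ν a
  let ℓ := minPosRowsN ((M.filter fun p => p.2 = x).map Prod.fst)
  fun b =>
    let adj : Multiset (ℕ × ℤ) → Multiset (ℕ × ℤ) :=
      Multiset.map fun p => (p.1, p.2 + if ℓ ≤ p.1 then A b a else 0)
    if b = a then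
      adj (M.erase (ℓ, x)) + (if ℓ = 1 then 0 else {(ℓ - 1, x + A a a / 2)})
    else adj (ν b)

/-- The crystal operator `e_a` on rigged configurations. -/
def eOp (A : I → I → ℤ) (a : I) (ν : RCraw I) : Option (RCraw I) :=
  if A a a = 2 then
    let x := minWith0 ((ν a).map Prod.snd)
    if x = 0 then none else some (eRemove A a ν x)
  else
    if ν a = 0 ∨ minPosRows ((ν a).map Prod.snd) ≠ -A a a / 2 then none
    else some (eRemove A a ν (-A a a / 2))

/-- The multiset of coriggings `p_i^(a) - x` of the (positive length) rows of `ν^(a)`. -/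
noncomputable def corigs (A : I → I → ℤ) (ν : RCraw I) (a : I) : Multiset ℤ :=
  (ν a).map fun p => vac A ν a p.1 - p.2

open scoped Classical in
/-- The star crystal operator `f_a^*`: add a box to a row of maximal length among the rows
of `ν^(a)` whose corigging equals the smallest corigging `x` (with the length-`0` rows of
corigging `0` included), set the rigging of the new row so that its corigging is
`x - A a a / 2`, and keep all other riggings fixed. -/
noncomputable def fStar (A : I → I → ℤ) (a : I) (ν : RCraw I) : RCraw I :=
  let M := ν a
  let x := minWith0 (corigs A ν a)
  let ℓ := maxWith0 ((M.filter fun p => vac A ν a p.1 - p.2 = x).map Prod.fst)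
  fun b =>
    if b = a then
      M.erase (ℓ, vac A ν a ℓ - x) + {(ℓ + 1, (vac A ν a (ℓ + 1) - A a a) - (x - A a a / 2))}
    else ν b

open scoped Classical in
/-- Auxiliary for `eStarOp`: remove a box from a row of minimal (positive) length among
the rows of `ν^(a)` with corigging `x`, set its rigging so that its corigging is
`x - A a a / 2` (dropping the row if its length becomes `0`), and keep all other riggings
fixed. -/
noncomputable def eStarRemove (A : I → I → ℤ) (a : I) (ν : RCraw I) (x : ℤ) : RCraw I :=
  let M := ν a
  let ℓ := minPosRowsN ((M.filter fun p => vac A ν a p.1 - p.2 = x).map Prod.fst)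
  fun b =>
    if b = a then
      M.erase (ℓ, vac A ν a ℓ - x) +
        (if ℓ = 1 then 0 else {(ℓ - 1, vac A ν a (ℓ - 1) - (x - A a a / 2))})
    else ν b

/-- The star crystal operator `e_a^*`. -/
noncomputable def eStarOp (A : I → I → ℤ) (a : I) (ν : RCraw I) : Option (RCraw I) :=
  if A a a = 2 then
    let x := minWith0 (corigs A ν a)
    if x = 0 then none else some (eStarRemove A a ν x)
  else
    if ν a = 0 ∨ minPosRows (corigs A ν a) ≠ -A a a / 2 then none
    else some (eStarRemove A a ν (-A a a / 2))

/-- `RC(∞)`: the set of rigged configurations generated from the empty rigged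
configuration by the operators `e_a`, `f_a`. -/
inductive RCinf (A : I → I → ℤ) : RCraw I → Prop
  | empty : RCinf A emptyRC
  | fstep (a : I) (ν : RCraw I) : RCinf A ν → RCinf A (fOp A a ν)
  | estep (a : I) (ν ν' : RCraw I) : RCinf A ν → eOp A a ν = some ν' → RCinf A ν'

/-- `RC(∞)^*`: the set of rigged configurations generated from the empty rigged
configuration by the operators `e_a^*`, `f_a^*`. -/
inductive RCinfStar (A : I → I → ℤ) : RCraw I → Prop
  | empty : RCinfStar A emptyRC
  | fstep (a : I) (ν : RCraw I) : RCinfStar A ν → RCinfStar A (fStar A a ν)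
  | estep (a : I) (ν ν' : RCraw I) : RCinfStar A ν → eStarOp A a ν = some ν' → RCinfStar A ν'

/-- Iteration of a partial map. -/
def iterOpt {α : Type*} (g : α → Option α) : ℕ → α → Option α
  | 0, v => some v
  | k + 1, v => (iterOpt g k v).bind g

/-- `tε_a(ν,J) = max {k | e_a^k (ν,J) ≠ 0}`. -/
noncomputable def teRC (A : I → I → ℤ) (a : I) (ν : RCraw I) : ℕ :=
  sSup {k | iterOpt (eOp A a) k ν ≠ none}

/-- `tε_a^*(ν,J) = max {k | (e_a^*)^k (ν,J) ≠ 0}`. -/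
noncomputable def teStarRC (A : I → I → ℤ) (a : I) (ν : RCraw I) : ℕ :=
  sSup {k | iterOpt (eStarOp A a) k ν ≠ none}

/-- `ε_a`: for real `a` the maximal number of applications of `e_a`, for imaginary `a`
zero. -/
noncomputable def epsRC (A : I → I → ℤ) (a : I) (ν : RCraw I) : ℤ :=
  if A a a = 2 then (teRC A a ν : ℤ) else 0

/-- `φ_a(ν,J) = ⟨h_a, wt(ν,J)⟩ + ε_a(ν,J)`. -/
noncomputable def phiRC (A : I → I → ℤ) (a : I) (ν : RCraw I) : ℤ :=
  pInf A ν a + epsRC A a ν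

/-- `ε_a^*`: for real `a` the maximal number of applications of `e_a^*`, for imaginary `a`
zero. -/
noncomputable def epsStarRC (A : I → I → ℤ) (a : I) (ν : RCraw I) : ℤ :=
  if A a a = 2 then (teStarRC A a ν : ℤ) else 0

/-- `φ_a^*(ν,J) = ⟨h_a, wt(ν,J)⟩ + ε_a^*(ν,J)`. -/
noncomputable def phiStarRC (A : I → I → ℤ) (a : I) (ν : RCraw I) : ℤ :=
  pInf A ν a + epsStarRC A a ν

/-- The weight of a rigged configuration, as the coefficient function of
`-∑_a |ν^(a)| α_a`. -/
def wtRC (ν : RCraw I) : I → ℤ := fun b => -rcSize ν b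

/-- For imaginary `a`, `κ_a(ν,J) = tε_a^*(ν,J)·A a a + ⟨h_a, wt(ν,J)⟩`. -/
noncomputable def kappaRC (A : I → I → ℤ) (a : I) (ν : RCraw I) : ℤ :=
  (teStarRC A a ν : ℤ) * A a a + pInf A ν a

/-- For imaginary `a`, `κ_a^*(ν,J) = tε_a(ν,J)·A a a + ⟨h_a, wt(ν,J)⟩`. -/
noncomputable def kappaStarRC (A : I → I → ℤ) (a : I) (ν : RCraw I) : ℤ :=
  (teRC A a ν : ℤ) * A a a + pInf A ν a

/-! ### Folds -/

theorem minWith0_spec (s : Multiset ℤ) :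
    (minWith0 s ≤ 0 ∧ ∀ z ∈ s, minWith0 s ≤ z) ∧ (minWith0 s = 0 ∨ minWith0 s ∈ s) := by
  unfold minWith0
  induction s using Multiset.induction with
  | empty => simp
  | cons a s ih =>
    rw [Multiset.fold_cons_left]
    obtain ⟨⟨h1, h2⟩, h3⟩ := ih
    refine ⟨⟨?_, ?_⟩, ?_⟩
    · exact (min_le_right _ _).trans h1
    · intro z hz
      rcases Multiset.mem_cons.1 hz with rfl | hz
      · exact min_le_left _ _
      · exact (min_le_right _ _).trans (h2 z hz)
    · rcases min_choice a (Multiset.fold min 0 s) with h | h <;> rw [h]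
      · right; simp
      · rcases h3 with h3 | h3
        · left; exact h3
        · right; exact Multiset.mem_cons_of_mem h3

theorem maxWith0_spec (s : Multiset ℕ) :
    (∀ z ∈ s, z ≤ maxWith0 s) ∧ (maxWith0 s = 0 ∨ maxWith0 s ∈ s) := by
  unfold maxWith0
  induction s using Multiset.induction with
  | empty => simp
  | cons a s ih =>
    rw [Multiset.fold_cons_left]
    obtain ⟨h2, h3⟩ := ih
    refine ⟨?_, ?_⟩
    · intro z hz
      rcases Multiset.mem_cons.1 hz with rfl | hz
      · exact le_max_left _ _
      · exact (h2 z hz).trans (le_max_right _ _)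
    · rcases max_choice a (Multiset.fold max 0 s) with h | h <;> rw [h]
      · right; simp
      · rcases h3 with h3 | h3
        · left; exact h3
        · right; exact Multiset.mem_cons_of_mem h3

theorem foldmin_le {α : Type*} [LinearOrder α] (s : Multiset α) (t : α) :
    ((s.fold min t) ≤ t ∧ ∀ z ∈ s, s.fold min t ≤ z) ∧ (s.fold min t = t ∨ s.fold min t ∈ s) := by
  induction s using Multiset.induction with
  | empty => simp
  | cons a s ih =>
    rw [Multiset.fold_cons_left]
    obtain ⟨⟨h1, h2⟩, h3⟩ := ih
    refine ⟨⟨?_, ?_⟩, ?_⟩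
    · exact (min_le_right _ _).trans h1
    · intro z hz
      rcases Multiset.mem_cons.1 hz with rfl | hz
      · exact min_le_left _ _
      · exact (min_le_right _ _).trans (h2 z hz)
    · rcases min_choice a (Multiset.fold min t s) with h | h <;> rw [h]
      · right; simp
      · rcases h3 with h3 | h3
        · left; exact h3
        · right; exact Multiset.mem_cons_of_mem h3

theorem le_foldmax {α : Type*} [LinearOrder α] (s : Multiset α) (t : α) :
    ∀ z ∈ s, z ≤ s.fold max t := by
  induction s using Multiset.induction with
  | empty => simp
  | cons a s ih =>
    rw [Multiset.fold_cons_left]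
    intro z hz
    rcases Multiset.mem_cons.1 hz with rfl | hz
    · exact le_max_left _ _
    · exact (ih z hz).trans (le_max_right _ _)

theorem foldminmax_eq {α : Type*} [LinearOrder α] (s : Multiset α) (t z : α) (hz : z ∈ s)
    (h : ∀ w ∈ s, z ≤ w) : s.fold min (s.fold max t) = z := by
  obtain ⟨⟨h1, h2⟩, h3⟩ := foldmin_le s (s.fold max t)
  apply le_antisymm (h2 z hz)
  rcases h3 with h3 | h3
  · rw [h3]; exact le_foldmax s t z hz
  · exact h _ h3

theorem foldminmax_mem {α : Type*} [LinearOrder α] (s : Multiset α) (t : α) (hs : s ≠ 0) :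
    s.fold min (s.fold max t) ∈ s ∧ ∀ w ∈ s, s.fold min (s.fold max t) ≤ w := by
  obtain ⟨⟨h1, h2⟩, h3⟩ := foldmin_le s (s.fold max t)
  refine ⟨?_, h2⟩
  rcases h3 with h3 | h3
  · obtain ⟨z, hz⟩ := Multiset.exists_mem_of_ne_zero hs
    have e : s.fold min (s.fold max t) = z :=
      le_antisymm (h2 z hz) (by rw [h3]; exact le_foldmax s t z hz)
    rw [e]; exact hz
  · exact h3

theorem minWith0_eq (s : Multiset ℤ) (z : ℤ) (hz : z = 0 ∨ z ∈ s) (h0 : z ≤ 0)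
    (h : ∀ w ∈ s, z ≤ w) : minWith0 s = z := by
  obtain ⟨⟨h1, h2⟩, h3⟩ := minWith0_spec s
  apply le_antisymm
  · rcases hz with rfl | hz
    · exact h1
    · exact h2 z hz
  · rcases h3 with h3 | h3
    · rw [h3]; exact h0
    · exact h _ h3

theorem maxWith0_eq (s : Multiset ℕ) (z : ℕ) (hz : z = 0 ∨ z ∈ s)
    (h : ∀ w ∈ s, w ≤ z) : maxWith0 s = z := by
  obtain ⟨h2, h3⟩ := maxWith0_spec s
  apply le_antisymm
  · rcases h3 with h3 | h3
    · rw [h3]; exact Nat.zero_le _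
    · exact h _ h3
  · rcases hz with rfl | hz
    · exact Nat.zero_le _
    · exact h2 z hz

/-! ### Rows, selection -/

/-- The multiset consisting of one row (nothing if the row has length zero). -/
def rowm (l : ℕ) (r : ℤ) : Multiset (ℕ × ℤ) := if l = 0 then 0 else {(l, r)}

/-- Membership including the virtual row. -/
def VV (M : Multiset (ℕ × ℤ)) (q : ℕ × ℤ) : Prop := q = (0, 0) ∨ q ∈ M

/-- The row `(l, r)` is a longest row among those minimizing `g`. -/
structure Sel (g : ℕ × ℤ → ℤ) (M : Multiset (ℕ × ℤ)) (l : ℕ) (r : ℤ) : Prop where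
  mem : VV M (l, r)
  le : ∀ q, VV M q → g (l, r) ≤ g q
  len : ∀ q, VV M q → g q = g (l, r) → q.1 ≤ l

theorem exists_sel (g : ℕ × ℤ → ℤ) (M : Multiset (ℕ × ℤ)) : ∃ l r, Sel g M l r := by
  obtain ⟨⟨l, r⟩, h1, h2⟩ := Finset.exists_min_image (insert (0, 0) M.toFinset)
    (fun q => toLex (g q, -(q.1 : ℤ))) ⟨(0, 0), by simp⟩
  refine ⟨l, r, by simpa [VV] using h1, ?_, ?_⟩
  · intro q hq
    have := h2 q (by simpa [VV] using hq)
    rw [Prod.Lex.toLex_le_toLex] at this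
    rcases this with h | h
    · exact h.le
    · exact h.1.le
  · intro q hq hg
    have := h2 q (by simpa [VV] using hq)
    rw [Prod.Lex.toLex_le_toLex] at this
    rcases this with h | h
    · simp only at h; omega
    · have := h.2; simp only at this; omega

/-- Basic well-formedness. -/
structure Ok (ν : RCraw I) : Prop where
  fin : {b | ν b ≠ 0}.Finite
  pos : ∀ b, ∀ q ∈ ν b, 0 < q.1

/-- Shift of riggings. -/
def sh (l : ℕ) (k : ℤ) (q : ℕ × ℤ) : ℕ × ℤ := (q.1, q.2 - if l < q.1 then k else 0)

theorem erase_rowm {l : ℕ} {r : ℤ} {M R : Multiset (ℕ × ℤ)} (hpos : ∀ q ∈ M, 0 < q.1)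
    (hR : M = rowm l r + R) : M.erase (l, r) = R := by
  subst hR
  unfold rowm at *
  split_ifs with h
  · subst h
    rw [zero_add]
    apply Multiset.erase_of_notMem
    intro hm
    have := hpos (0, r) (by simpa using hm)
    simp at this
  · simp

theorem VV.decomp {l : ℕ} {r : ℤ} {M : Multiset (ℕ × ℤ)} (h : VV M (l, r)) :
    ∃ R, M = rowm l r + R := by
  unfold rowm
  split_ifs with hl
  · exact ⟨M, by simp⟩
  · rcases h with h | h
    · simp at h; omega
    · obtain ⟨R, hR⟩ := Multiset.exists_cons_of_mem h
      exact ⟨R, by rw [hR]; simp⟩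

theorem mem_rowm {l : ℕ} {r : ℤ} {q : ℕ × ℤ} : q ∈ rowm l r ↔ l ≠ 0 ∧ q = (l, r) := by
  unfold rowm; split_ifs with h <;> simp [h]

theorem Sel.zero {g : ℕ × ℤ → ℤ} {M : Multiset (ℕ × ℤ)} {r : ℤ} (h : Sel g M 0 r)
    (hpos : ∀ q ∈ M, 0 < q.1) : r = 0 := by
  rcases h.mem with h | h
  · simpa using h
  · simpa using hpos _ h

theorem fOp_self (A : I → I → ℤ) {a : I} {ν : RCraw I} {l : ℕ} {r : ℤ} {R : Multiset (ℕ × ℤ)}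
    (hpos : ∀ q ∈ ν a, 0 < q.1)
    (hs : Sel Prod.snd (ν a) l r) (hR : ν a = rowm l r + R) :
    fOp A a ν a = R.map (sh l (A a a)) + {(l + 1, r - A a a / 2)} ∧
    ∀ b, b ≠ a → fOp A a ν b = (ν b).map (sh l (A b a)) := by
  have hx : minWith0 ((ν a).map Prod.snd) = r := by
    apply minWith0_eq
    · rcases hs.mem with h | h
      · left; simp at h; exact h.2
      · right; exact Multiset.mem_map_of_mem Prod.snd h
    · exact hs.le (0, 0) (Or.inl rfl)
    · intro w hw
      obtain ⟨q, hq, rfl⟩ := Multiset.mem_map.1 hw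
      exact hs.le q (Or.inr hq)
  have hl : maxWith0 (((ν a).filter fun p => p.2 = r).map Prod.fst) = l := by
    apply maxWith0_eq
    · rcases hs.mem with h | h
      · left; simp at h; exact h.1
      · right; exact Multiset.mem_map.2 ⟨(l, r), by simp [h], rfl⟩
    · intro w hw
      obtain ⟨q, hq, rfl⟩ := Multiset.mem_map.1 hw
      rw [Multiset.mem_filter] at hq
      exact hs.len q (Or.inr hq.1) hq.2
  constructor
  · simp only [fOp, hx, hl, if_true, erase_rowm hpos hR]
    rfl
  · intro b hb
    simp only [fOp, hx, hl, if_neg hb]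
    rfl

/-- Coriggings. -/
noncomputable def cor (A : I → I → ℤ) (ν : RCraw I) (a : I) (q : ℕ × ℤ) : ℤ :=
  vac A ν a q.1 - q.2

theorem vac_zero (A : I → I → ℤ) (ν : RCraw I) (a : I) : vac A ν a 0 = 0 := by
  unfold vac
  rw [neg_eq_zero]
  apply finsum_eq_zero_of_forall_eq_zero
  intro b
  have : ((ν b).map fun p => (min (0 : ℕ) p.1 : ℤ)) = (ν b).map fun _ => (0 : ℤ) := by
    apply Multiset.map_congr rfl
    intro q _
    simp
  rw [this]; simp

theorem IsBorcherdsCartan.half {A : I → I → ℤ} (hA : IsBorcherdsCartan A) (a : I) :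
    ∃ h, A a a = 2 * h ∧ A a a / 2 = h := by
  rcases hA.diag a with h | ⟨_, h⟩
  · exact ⟨1, by omega, by omega⟩
  · obtain ⟨k, hk⟩ := h
    exact ⟨k, by omega, by omega⟩

theorem fStar_self {A : I → I → ℤ} (hA : IsBorcherdsCartan A) {a : I} {ν : RCraw I} {l : ℕ} {r : ℤ}
    {R : Multiset (ℕ × ℤ)} (hpos : ∀ q ∈ ν a, 0 < q.1)
    (hs : Sel (cor A ν a) (ν a) l r) (hR : ν a = rowm l r + R) :
    fStar A a ν a = R + {(l + 1, r + (vac A ν a (l + 1) - vac A ν a l) - A a a / 2)} ∧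
    ∀ b, b ≠ a → fStar A a ν b = ν b := by
  have hx : minWith0 (corigs A ν a) = vac A ν a l - r := by
    apply minWith0_eq
    · rcases hs.mem with h | h
      · left; simp at h; rw [h.1, h.2, vac_zero]; simp
      · right; exact Multiset.mem_map.2 ⟨(l, r), h, rfl⟩
    · have := hs.le (0, 0) (Or.inl rfl)
      simpa [cor, vac_zero] using this
    · intro w hw
      obtain ⟨q, hq, rfl⟩ := Multiset.mem_map.1 hw
      exact hs.le q (Or.inr hq)
  have hl : maxWith0 (((ν a).filter fun p => vac A ν a p.1 - p.2 = vac A ν a l - r).map Prod.fst)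
      = l := by
    apply maxWith0_eq
    · rcases hs.mem with h | h
      · left; simp at h; exact h.1
      · right; exact Multiset.mem_map.2 ⟨(l, r), by simp [h], rfl⟩
    · intro w hw
      obtain ⟨q, hq, rfl⟩ := Multiset.mem_map.1 hw
      rw [Multiset.mem_filter] at hq
      exact hs.len q (Or.inr hq.1) hq.2
  have hl' : maxWith0 ((@Multiset.filter _ (fun p : ℕ × ℤ => vac A ν a p.1 - p.2 = vac A ν a l - r)
      (fun _ => Classical.propDecidable _) (ν a)).map Prod.fst) = l := by
    convert hl
  obtain ⟨h, h1, h2⟩ := hA.half a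
  constructor
  · have he := erase_rowm hpos hR
    have e1 : vac A ν a l - (vac A ν a l - r) = r := by ring
    have e2 : vac A ν a (l + 1) - A a a - (vac A ν a l - r - A a a / 2) =
      r + (vac A ν a (l + 1) - vac A ν a l) - A a a / 2 := by rw [h2, h1]; ring
    simp only [fStar, hx, hl, hl', if_true, e1, e2]
    rw [← he]
  · intro b hb
    simp only [fStar, if_neg hb]

/-! ### Vacancy numbers -/

/-- Truncated size. -/
def Ss (M : Multiset (ℕ × ℤ)) (i : ℕ) : ℤ := (M.map fun p => (min i p.1 : ℤ)).sum

theorem Ss_add (M N : Multiset (ℕ × ℤ)) (i : ℕ) : Ss (M + N) i = Ss M i + Ss N i := by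
  simp [Ss]

theorem Ss_map (M : Multiset (ℕ × ℤ)) (g : ℕ × ℤ → ℕ × ℤ) (hg : ∀ q, (g q).1 = q.1) (i : ℕ) :
    Ss (M.map g) i = Ss M i := by
  simp [Ss, Multiset.map_map, hg]

theorem Ss_single (l : ℕ) (r : ℤ) (i : ℕ) : Ss {(l, r)} i = min (i : ℤ) l := by
  simp [Ss]

theorem Ss_rowm (l : ℕ) (r : ℤ) (i : ℕ) : Ss (rowm l r) i = min (i : ℤ) l := by
  unfold rowm
  split_ifs with h
  · simp [Ss, h]
  · exact Ss_single l r i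

theorem vac_eq_sum (A : I → I → ℤ) (ν : RCraw I) (a : I) (i : ℕ) (s : Finset I)
    (hs : ∀ b, ν b ≠ 0 → b ∈ s) : vac A ν a i = -∑ b ∈ s, A a b * Ss (ν b) i := by
  unfold vac
  rw [neg_inj]
  apply finsum_eq_sum_of_support_subset
  intro b hb
  apply hs
  intro h0
  apply hb
  simp [h0]

theorem Ok.exists_finset {ν : RCraw I} (h : Ok ν) (a : I) :
    ∃ s : Finset I, a ∈ s ∧ ∀ b, ν b ≠ 0 → b ∈ s :=
  ⟨insert a h.fin.toFinset, by simp, fun b hb => by simp [hb]⟩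

theorem vac_congr (A : I → I → ℤ) {ν ν' : RCraw I} (h : ∀ b i, Ss (ν' b) i = Ss (ν b) i)
    (b : I) (i : ℕ) : vac A ν' b i = vac A ν b i := by
  have h' : ∀ (b : I) (i : ℕ), ((ν' b).map fun p => (min i p.1 : ℤ)).sum =
    ((ν b).map fun p => (min i p.1 : ℤ)).sum := h
  unfold vac
  simp only [h']

theorem vac_step (A : I → I → ℤ) {a : I} {ν ν' : RCraw I} (hν : Ok ν) (hν' : Ok ν') (l : ℕ)
    (h : ∀ b i, Ss (ν' b) i = Ss (ν b) i + if b = a then (if l < i then 1 else 0) else 0)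
    (b : I) (i : ℕ) :
    vac A ν' b i = vac A ν b i - if l < i then A b a else 0 := by
  obtain ⟨s, has, hs⟩ := hν.exists_finset a
  obtain ⟨s', _, hs'⟩ := hν'.exists_finset a
  rw [vac_eq_sum A ν b i (s ∪ s') (fun c hc => Finset.mem_union_left _ (hs c hc)),
    vac_eq_sum A ν' b i (s ∪ s') (fun c hc => Finset.mem_union_right _ (hs' c hc))]
  simp only [h, mul_add, Finset.sum_add_distrib]
  have : ∑ x ∈ s ∪ s', A b x * (if x = a then (if l < i then 1 else 0) else 0) =
      if l < i then A b a else 0 := by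
    simp [has]
  rw [this]; ring

theorem sum_split {A : I → I → ℤ} (hA : IsBorcherdsCartan A) {ν : RCraw I} (hν : Ok ν) (a : I)
    (G : Multiset (ℕ × ℤ) → ℤ) (hG : ∀ M, 0 ≤ G M) (s : Finset I)
    (has : a ∈ s) :
    ∃ N : ℤ, 0 ≤ N ∧ ∑ b ∈ s, A a b * G (ν b) = A a a * G (ν a) - N ∧
      (N = 0 → ∀ b ∈ s, b ≠ a → A b a ≠ 0 → G (ν b) = 0) := by
  refine ⟨∑ b ∈ s.erase a, -(A a b) * G (ν b), ?_, ?_, ?_⟩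
  · apply Finset.sum_nonneg
    intro b hb
    have := hA.offdiag a b (Finset.ne_of_mem_erase hb).symm
    exact mul_nonneg (by omega) (hG _)
  · rw [← Finset.add_sum_erase _ _ has]
    simp
  · intro h b hb hba hne
    rw [Finset.sum_eq_zero_iff_of_nonneg] at h
    · have := h b (Finset.mem_erase.2 ⟨hba, hb⟩)
      have h2 : A a b ≠ 0 := fun h => hne ((hA.zero_iff a b).1 h)
      rcases mul_eq_zero.1 this with h | h
      · omega
      · exact h
    · intro b hb
      have := hA.offdiag a b (Finset.ne_of_mem_erase hb).symm
      exact mul_nonneg (by omega) (hG _)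

/-- Number of rows longer than `i`. -/
def gtc (M : Multiset (ℕ × ℤ)) (i : ℕ) : ℤ := (M.countP (fun q => i < q.1) : ℕ)
/-- Number of rows of length `i`. -/
def eqc (M : Multiset (ℕ × ℤ)) (i : ℕ) : ℤ := (M.countP (fun q => q.1 = i) : ℕ)

theorem Ss_succ (M : Multiset (ℕ × ℤ)) (i : ℕ) : Ss M (i + 1) = Ss M i + gtc M i := by
  induction M using Multiset.induction with
  | empty => simp [Ss, gtc]
  | cons q M ih =>
    rw [← Multiset.singleton_add, Ss_add, Ss_add, ih]
    obtain ⟨l, r⟩ := q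
    rw [Ss_single, Ss_single]
    simp only [gtc, Multiset.singleton_add, Multiset.countP_cons]
    push_cast
    split_ifs <;> omega

theorem gtc_succ (M : Multiset (ℕ × ℤ)) (i : ℕ) : gtc M (i + 1) = gtc M i - eqc M (i + 1) := by
  induction M using Multiset.induction with
  | empty => simp [eqc, gtc]
  | cons q M ih =>
    simp only [gtc, eqc, Multiset.countP_cons] at *
    push_cast
    split_ifs <;> omega

theorem gtc_eq_zero {M : Multiset (ℕ × ℤ)} {i : ℕ} : gtc M i = 0 ↔ ∀ q ∈ M, q.1 ≤ i := by
  simp [gtc, Multiset.countP_eq_zero]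

theorem eqc_eq_zero {M : Multiset (ℕ × ℤ)} {i : ℕ} : eqc M i = 0 ↔ ∀ q ∈ M, q.1 ≠ i := by
  simp [eqc, Multiset.countP_eq_zero]

theorem vac_mono {A : I → I → ℤ} (hA : IsBorcherdsCartan A) {ν : RCraw I} (hν : Ok ν) (a : I)
    (i : ℕ) : ∃ N : ℤ, 0 ≤ N ∧ vac A ν a (i + 1) = vac A ν a i + N - A a a * gtc (ν a) i ∧
      (N = 0 → ∀ b, b ≠ a → A b a ≠ 0 → ∀ q ∈ ν b, q.1 ≤ i) := by
  obtain ⟨s, has, hs⟩ := hν.exists_finset a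
  obtain ⟨N, h0, h1, h2⟩ := sum_split hA hν a (fun M => gtc M i)
    (fun M => by simp [gtc]) s has
  refine ⟨N, h0, ?_, ?_⟩
  · rw [vac_eq_sum A ν a _ s hs, vac_eq_sum A ν a _ s hs]
    simp only [Ss_succ, mul_add, Finset.sum_add_distrib]
    rw [h1]; ring
  · intro hN b hb hne
    by_cases hbs : b ∈ s
    · exact gtc_eq_zero.1 (h2 hN b hbs hb hne)
    · have : ν b = 0 := by by_contra h; exact hbs (hs b h)
      simp [this]

theorem vac_conc {A : I → I → ℤ} (hA : IsBorcherdsCartan A) {ν : RCraw I} (hν : Ok ν) (a : I)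
    (i : ℕ) : ∃ N : ℤ, 0 ≤ N ∧ vac A ν a (i + 2) - vac A ν a (i + 1) =
        vac A ν a (i + 1) - vac A ν a i + A a a * eqc (ν a) (i + 1) - N ∧
      (N = 0 → ∀ b, b ≠ a → A b a ≠ 0 → ∀ q ∈ ν b, q.1 ≠ i + 1) := by
  obtain ⟨s, has, hs⟩ := hν.exists_finset a
  obtain ⟨N, h0, h1, h2⟩ := sum_split hA hν a (fun M => eqc M (i + 1))
    (fun M => by simp [eqc]) s has
  refine ⟨N, h0, ?_, ?_⟩
  · rw [vac_eq_sum A ν a _ s hs, vac_eq_sum A ν a _ s hs, vac_eq_sum A ν a _ s hs]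
    simp only [Ss_succ, gtc_succ, mul_add, mul_sub, Finset.sum_add_distrib, Finset.sum_sub_distrib]
    rw [h1]; ring
  · intro hN b hb hne
    by_cases hbs : b ∈ s
    · exact eqc_eq_zero.1 (h2 hN b hbs hb hne)
    · have : ν b = 0 := by by_contra h; exact hbs (hs b h)
      simp [this]

/-! ### Effect of the operators -/

theorem fOp_ok {A : I → I → ℤ} {a : I} {ν : RCraw I} (hν : Ok ν) : Ok (fOp A a ν) := by
  obtain ⟨l, r, hs⟩ := exists_sel Prod.snd (ν a)
  obtain ⟨R, hR⟩ := hs.mem.decomp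
  obtain ⟨h1, h2⟩ := fOp_self A (hν.pos a) hs hR
  constructor
  · apply (hν.fin.insert a).subset
    intro b hb
    by_cases hba : b = a
    · left; exact hba
    · right
      intro h
      apply hb
      rw [h2 b hba, h]; rfl
  · intro b q hq
    by_cases hba : b = a
    · subst hba
      rw [h1] at hq
      rcases Multiset.mem_add.1 hq with hq | hq
      · obtain ⟨q', hq', rfl⟩ := Multiset.mem_map.1 hq
        exact hν.pos b q' (by rw [hR]; exact Multiset.mem_add.2 (Or.inr hq'))
      · rw [Multiset.mem_singleton.1 hq]; simp
    · rw [h2 b hba] at hq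
      obtain ⟨q', hq', rfl⟩ := Multiset.mem_map.1 hq
      exact hν.pos b q' hq'

theorem fStar_ok {A : I → I → ℤ} (hA : IsBorcherdsCartan A) {a : I} {ν : RCraw I} (hν : Ok ν) :
    Ok (fStar A a ν) := by
  obtain ⟨l, r, hs⟩ := exists_sel (cor A ν a) (ν a)
  obtain ⟨R, hR⟩ := hs.mem.decomp
  obtain ⟨h1, h2⟩ := fStar_self hA (hν.pos a) hs hR
  constructor
  · apply (hν.fin.insert a).subset
    intro b hb
    by_cases hba : b = a
    · left; exact hba
    · right
      intro h
      apply hb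
      rw [h2 b hba, h]
  · intro b q hq
    by_cases hba : b = a
    · subst hba
      rw [h1] at hq
      rcases Multiset.mem_add.1 hq with hq | hq
      · exact hν.pos b q (by rw [hR]; exact Multiset.mem_add.2 (Or.inr hq))
      · rw [Multiset.mem_singleton.1 hq]; simp
    · rw [h2 b hba] at hq
      exact hν.pos b q hq

theorem min_succ_sub (i l : ℕ) :
    min (i : ℤ) ((l + 1 : ℕ) : ℤ) = min (i : ℤ) l + if l < i then 1 else 0 := by
  split_ifs <;> omega

theorem fOp_vac {A : I → I → ℤ} {a : I} {ν : RCraw I} (hν : Ok ν) {l : ℕ} {r : ℤ}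
    (hs : Sel Prod.snd (ν a) l r) (b : I) (i : ℕ) :
    vac A (fOp A a ν) b i = vac A ν b i - if l < i then A b a else 0 := by
  obtain ⟨R, hR⟩ := hs.mem.decomp
  obtain ⟨h1, h2⟩ := fOp_self A (hν.pos a) hs hR
  apply vac_step A hν (fOp_ok hν)
  intro b i
  by_cases hba : b = a
  · subst hba
    rw [h1, Ss_add, Ss_map _ (sh l (A b b)) (fun _ => rfl), Ss_single, min_succ_sub, hR, Ss_add, Ss_rowm]
    simp; ring
  · rw [h2 b hba, Ss_map _ (sh l (A b a)) (fun _ => rfl)]; simp [hba]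

theorem fStar_vac {A : I → I → ℤ} (hA : IsBorcherdsCartan A) {a : I} {ν : RCraw I} (hν : Ok ν)
    {l : ℕ} {r : ℤ} (hs : Sel (cor A ν a) (ν a) l r) (b : I) (i : ℕ) :
    vac A (fStar A a ν) b i = vac A ν b i - if l < i then A b a else 0 := by
  obtain ⟨R, hR⟩ := hs.mem.decomp
  obtain ⟨h1, h2⟩ := fStar_self hA (hν.pos a) hs hR
  apply vac_step A hν (fStar_ok hA hν)
  intro b i
  by_cases hba : b = a
  · subst hba
    rw [h1, Ss_add, Ss_single, min_succ_sub, hR, Ss_add, Ss_rowm]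
    simp; ring
  · rw [h2 b hba]; simp [hba]

/-! ### The duality exchanging riggings and coriggings -/

/-- Replace riggings by coriggings. -/
noncomputable def theta (A : I → I → ℤ) (ν : RCraw I) : RCraw I :=
  fun b => (ν b).map fun q => (q.1, vac A ν b q.1 - q.2)

theorem theta_vac (A : I → I → ℤ) (ν : RCraw I) (b : I) (i : ℕ) :
    vac A (theta A ν) b i = vac A ν b i :=
  vac_congr A (fun b i => Ss_map (ν b) (fun q => (q.1, vac A ν b q.1 - q.2)) (fun _ => rfl) i) b i

theorem theta_theta (A : I → I → ℤ) (ν : RCraw I) : theta A (theta A ν) = ν := by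
  funext b
  have e : theta A (theta A ν) b = (theta A ν b).map fun q => (q.1, vac A (theta A ν) b q.1 - q.2) :=
    rfl
  have e2 : theta A ν b = (ν b).map fun q => (q.1, vac A ν b q.1 - q.2) := rfl
  rw [e, e2, Multiset.map_map]
  conv_rhs => rw [← Multiset.map_id (ν b)]
  apply Multiset.map_congr rfl
  intro q _
  simp [theta_vac]

theorem theta_ok {A : I → I → ℤ} {ν : RCraw I} (hν : Ok ν) : Ok (theta A ν) := by
  constructor
  · apply hν.fin.subset
    intro b hb h
    apply hb
    simp [theta, h]
  · intro b q hq
    obtain ⟨q', hq', rfl⟩ := Multiset.mem_map.1 hq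
    exact hν.pos b q' hq'

theorem theta_VV {A : I → I → ℤ} {ν : RCraw I} {a : I} {q : ℕ × ℤ} (h : VV (theta A ν a) q) :
    VV (ν a) (q.1, vac A ν a q.1 - q.2) := by
  rcases h with rfl | h
  · left; simp [vac_zero]
  · right
    obtain ⟨q', hq', rfl⟩ := Multiset.mem_map.1 h
    simpa using hq'

theorem theta_VV' {A : I → I → ℤ} {ν : RCraw I} {a : I} {q : ℕ × ℤ} (h : VV (ν a) q) :
    VV (theta A ν a) (q.1, vac A ν a q.1 - q.2) := by
  rcases h with rfl | h
  · left; simp [vac_zero]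
  · right
    exact Multiset.mem_map.2 ⟨q, h, rfl⟩

theorem theta_sel {A : I → I → ℤ} {ν : RCraw I} {a : I} {l : ℕ} {r : ℤ}
    (h : Sel Prod.snd (theta A ν a) l r) : Sel (cor A ν a) (ν a) l (vac A ν a l - r) := by
  refine ⟨theta_VV h.mem, ?_, ?_⟩
  · intro q hq
    have := h.le _ (theta_VV' (A := A) hq)
    simpa [cor] using this
  · intro q hq hc
    exact h.len (q.1, vac A ν a q.1 - q.2) (theta_VV' (A := A) hq) (by simpa [cor] using hc)

theorem theta_fStar {A : I → I → ℤ} (hA : IsBorcherdsCartan A) {a : I} {ν : RCraw I} (hν : Ok ν) :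
    theta A (fStar A a ν) = fOp A a (theta A ν) := by
  obtain ⟨l, r, hs⟩ := exists_sel Prod.snd (theta A ν a)
  have hs' := theta_sel hs
  obtain ⟨R, hR⟩ := hs'.mem.decomp
  obtain ⟨h1, h2⟩ := fStar_self hA (hν.pos a) hs' hR
  have hR' : theta A ν a = rowm l r + R.map (fun q => (q.1, vac A ν a q.1 - q.2)) := by
    unfold theta
    rw [hR, Multiset.map_add]
    congr 1
    unfold rowm
    split_ifs <;> simp
  obtain ⟨g1, g2⟩ := fOp_self A ((theta_ok hν).pos a) hs hR'
  have hv := fStar_vac hA hν hs'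
  obtain ⟨h, hh1, hh2⟩ := hA.half a
  funext b
  by_cases hba : b = a
  · subst hba
    rw [g1]
    unfold theta
    rw [h1, Multiset.map_add, Multiset.map_map]
    congr 1
    · apply Multiset.map_congr rfl
      intro q _
      simp only [hv, sh, Function.comp]
      congr 1; ring
    · simp only [Multiset.map_singleton, hv]
      congr 2
      rw [hh2, hh1]; simp; ring
  · rw [g2 b hba]
    unfold theta
    rw [h2 b hba, Multiset.map_map]
    apply Multiset.map_congr rfl
    intro q _
    simp only [hv, sh, Function.comp]
    congr 1; ring

theorem theta_fOp {A : I → I → ℤ} (hA : IsBorcherdsCartan A) {a : I} {ν : RCraw I} (hν : Ok ν) :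
    theta A (fOp A a ν) = fStar A a (theta A ν) := by
  have := theta_fStar hA (a := a) (theta_ok (A := A) hν)
  rw [theta_theta] at this
  rw [← this, theta_theta]

/-! ### Concavity arguments -/

theorem right_flat {A : I → I → ℤ} (hA : IsBorcherdsCartan A) {ν : RCraw I} (hν : Ok ν) {a : I}
    {u : ℕ} {c : ℤ} (h1 : vac A ν a (u + 1) ≤ vac A ν a u) (h2 : vac A ν a (u + 1) ≤ c)
    (h3 : ∀ q ∈ ν a, u < q.1 → c < vac A ν a q.1) :
    (∀ q ∈ ν a, q.1 ≤ u) ∧ (∀ k, vac A ν a (u + k) = vac A ν a u) ∧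
      ∀ b, b ≠ a → A b a ≠ 0 → ∀ q ∈ ν b, q.1 ≤ u := by
  have key : ∀ k, vac A ν a (u + k + 1) ≤ c ∧ vac A ν a (u + k + 1) ≤ vac A ν a (u + k) := by
    intro k
    induction k with
    | zero => exact ⟨h2, h1⟩
    | succ k ih =>
      obtain ⟨N, hN, e, _⟩ := vac_conc hA hν a (u + k)
      have : eqc (ν a) (u + k + 1) = 0 := by
        rw [eqc_eq_zero]
        intro q hq hl
        have := h3 q hq (by omega)
        rw [hl] at this
        omega
      rw [this, mul_zero] at e
      have e1 : u + (k + 1) = u + k + 1 := by ring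
      rw [e1]
      have e2 : u + k + 1 + 1 = u + k + 2 := by ring
      rw [e2]
      constructor <;> omega
  have hrow : ∀ q ∈ ν a, q.1 ≤ u := by
    intro q hq
    by_contra hlt
    have := h3 q hq (by omega)
    have := (key (q.1 - u - 1)).1
    rw [show u + (q.1 - u - 1) + 1 = q.1 by omega] at this
    omega
  refine ⟨hrow, ?_, ?_⟩
  · intro k
    induction k with
    | zero => rfl
    | succ k ih =>
      obtain ⟨N, hN, e, _⟩ := vac_mono hA hν a (u + k)
      rw [gtc_eq_zero.2 (fun q hq => (hrow q hq).trans (by omega)), mul_zero] at e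
      have := (key k).2
      rw [show u + (k + 1) = u + k + 1 by ring]
      omega
  · obtain ⟨N, hN, e, h⟩ := vac_mono hA hν a u
    rw [gtc_eq_zero.2 hrow, mul_zero] at e
    exact h (by omega)

theorem core_left {A : I → I → ℤ} (hA : IsBorcherdsCartan A) {ν : RCraw I} (hν : Ok ν) {a : I}
    {v : ℕ} {c : ℤ} (h0 : c < 0) (hrows : ∀ q ∈ ν a, q.1 < v → c < vac A ν a q.1) :
    ∀ j, j < v → vac A ν a j ≤ c → vac A ν a j ≤ vac A ν a (j + 1) → False := by
  intro j
  induction j with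
  | zero => intro _ h; rw [vac_zero] at h; omega
  | succ j ih =>
    intro hj h1 h2
    obtain ⟨N, hN, e, _⟩ := vac_conc hA hν a j
    have : eqc (ν a) (j + 1) = 0 := by
      rw [eqc_eq_zero]
      intro q hq hl
      have := hrows q hq (by omega)
      rw [hl] at this
      omega
    rw [this, mul_zero] at e
    rw [show j + 1 + 1 = j + 2 by ring] at h2
    exact ih (by omega) (by omega) (by omega)

theorem flat_left {A : I → I → ℤ} (hA : IsBorcherdsCartan A) {ν : RCraw I} (hν : Ok ν) {a : I}
    {v : ℕ} {c : ℤ} (h0 : c ≤ 0) (hrows : ∀ q ∈ ν a, q.1 < v → c ≤ vac A ν a q.1) :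
    ∀ j, j < v → vac A ν a j = c → vac A ν a (j + 1) = c →
      ∃ i, i ≤ j ∧ vac A ν a i = c ∧ vac A ν a (i + 1) = c ∧ (i = 0 ∨ ∃ r, (i, r) ∈ ν a) ∧
        (∀ q ∈ ν a, i < q.1 → q.1 ≤ j → False) ∧
        (∀ b, b ≠ a → A b a ≠ 0 → ∀ q ∈ ν b, i < q.1 → q.1 ≤ j → False) := by
  intro j
  induction j with
  | zero =>
    intro _ h1 h2
    exact ⟨0, le_rfl, h1, h2, Or.inl rfl, fun _ _ _ _ => by omega, fun _ _ _ _ _ _ _ => by omega⟩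
  | succ j ih =>
    intro hj h1 h2
    by_cases hr : ∃ r, (j + 1, r) ∈ ν a
    · exact ⟨j + 1, le_rfl, h1, h2, Or.inr hr, fun _ _ _ _ => by omega,
        fun _ _ _ _ _ _ _ => by omega⟩
    · have hr' : ∀ q ∈ ν a, q.1 ≠ j + 1 := by
        intro q hq hl
        exact hr ⟨q.2, by rw [← hl]; exact hq⟩
      obtain ⟨N, hN, e, hn⟩ := vac_conc hA hν a j
      rw [eqc_eq_zero.2 hr', mul_zero] at e
      rw [show j + 1 + 1 = j + 2 by ring] at h2
      have hge : ¬ vac A ν a j ≤ c - 1 := by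
        intro hlt
        exact core_left hA hν (v := v) (c := c - 1) (by omega)
          (fun q hq hl => by have := hrows q hq hl; omega) j (by omega) hlt (by omega)
      obtain ⟨i, hi, g1, g2, g3, g4, g5⟩ := ih (by omega) (by omega) h1
      refine ⟨i, by omega, g1, g2, g3, ?_, ?_⟩
      · intro q hq hl hl2
        have := hr' q hq
        exact g4 q hq hl (by omega)
      · intro b hb hne q hq hl hl2
        have := hn (by omega) b hb hne q hq
        exact g5 b hb hne q hq hl (by omega)

/-! ### Commutation -/

theorem map_sh_congr {R : Multiset (ℕ × ℤ)} {l l' : ℕ} {k : ℤ}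
    (h : k ≠ 0 → ∀ q ∈ R, (l < q.1 ↔ l' < q.1)) : R.map (sh l k) = R.map (sh l' k) := by
  apply Multiset.map_congr rfl
  intro q hq
  unfold sh
  by_cases hk : k = 0
  · simp [hk]
  · simp [h hk q hq]

theorem map_sh_id {R : Multiset (ℕ × ℤ)} {l : ℕ} {k : ℤ}
    (h : k ≠ 0 → ∀ q ∈ R, q.1 ≤ l) : R.map (sh l k) = R := by
  conv_rhs => rw [← Multiset.map_id R]
  apply Multiset.map_congr rfl
  intro q hq
  unfold sh
  by_cases hk : k = 0
  · simp [hk]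
  · have := h hk q hq
    simp [not_lt.2 this]

theorem f_eq_fStar {A : I → I → ℤ} (hA : IsBorcherdsCartan A) {ν : RCraw I} (hν : Ok ν) {a : I}
    {l : ℕ} {r : ℤ} (hs : Sel Prod.snd (ν a) l r) (hs' : Sel (cor A ν a) (ν a) l r)
    (hD : vac A ν a (l + 1) = vac A ν a l) (ha : A a a ≠ 0 → ∀ q ∈ ν a, q.1 ≤ l)
    (hn : ∀ b, b ≠ a → A b a ≠ 0 → ∀ q ∈ ν b, q.1 ≤ l) : fOp A a ν = fStar A a ν := by
  obtain ⟨R, hR⟩ := hs.mem.decomp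
  obtain ⟨h1, h2⟩ := fOp_self A (hν.pos a) hs hR
  obtain ⟨g1, g2⟩ := fStar_self hA (hν.pos a) hs' hR
  funext b
  by_cases hb : b = a
  · subst hb
    rw [h1, g1, map_sh_id, hD]
    · simp
    · intro h0 q hq
      exact ha h0 q (by rw [hR]; exact Multiset.mem_add.2 (Or.inr hq))
  · rw [h2 b hb, g2 b hb, map_sh_id (hn b hb)]

theorem commute_ne {A : I → I → ℤ} (hA : IsBorcherdsCartan A) {ν : RCraw I} (hν : Ok ν) {a b : I}
    (hab : a ≠ b) : fOp A a (fStar A b ν) = fStar A b (fOp A a ν) := by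
  obtain ⟨l, r, hl⟩ := exists_sel Prod.snd (ν a)
  obtain ⟨m, s, hm⟩ := exists_sel (cor A ν b) (ν b)
  obtain ⟨R, hR⟩ := hl.mem.decomp
  obtain ⟨T, hT⟩ := hm.mem.decomp
  obtain ⟨f1, f2⟩ := fOp_self A (hν.pos a) hl hR
  obtain ⟨g1, g2⟩ := fStar_self hA (hν.pos b) hm hT
  have fv := fOp_vac (A := A) hν hl
  have ea : fStar A b ν a = ν a := g2 a hab
  obtain ⟨u1, u2⟩ := fOp_self A (ν := fStar A b ν) ((fStar_ok hA hν).pos a) (by rw [ea]; exact hl)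
    (by rw [ea]; exact hR)
  have eb : fOp A a ν b = (ν b).map (sh l (A b a)) := f2 b hab.symm
  have hcor : ∀ q, cor A (fOp A a ν) b (sh l (A b a) q) = cor A ν b q := by
    intro q
    simp only [cor, fv, sh]; ring
  have hz : sh l (A b a) (0, 0) = (0, 0) := by simp [sh]
  have hsel : Sel (cor A (fOp A a ν) b) (fOp A a ν b) m (sh l (A b a) (m, s)).2 := by
    have hm' := hcor (m, s)
    have e : (m, (sh l (A b a) (m, s)).2) = sh l (A b a) (m, s) := rfl
    rw [eb]
    refine ⟨?_, ?_, ?_⟩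
    · rw [e]
      rcases hm.mem with h | h
      · left; rw [h, hz]
      · right; exact Multiset.mem_map_of_mem _ h
    · rw [e, hm']
      rintro q (rfl | hq)
      · have := hcor (0, 0)
        rw [hz] at this
        rw [this]
        exact hm.le _ (Or.inl rfl)
      · obtain ⟨q', hq', rfl⟩ := Multiset.mem_map.1 hq
        rw [hcor]
        exact hm.le _ (Or.inr hq')
    · rw [e, hm']
      rintro q (rfl | hq)
      · simp
      · obtain ⟨q', hq', rfl⟩ := Multiset.mem_map.1 hq
        rw [hcor]
        exact hm.len _ (Or.inr hq')
  have hT' : fOp A a ν b = rowm m (sh l (A b a) (m, s)).2 + T.map (sh l (A b a)) := by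
    rw [eb, hT, Multiset.map_add]
    congr 1
    unfold rowm
    split_ifs <;> simp [sh]
  obtain ⟨v1, v2⟩ := fStar_self hA ((fOp_ok (A := A) (a := a) hν).pos b) hsel hT'
  funext c
  by_cases hca : c = a
  · subst hca
    rw [u1, v2 c hab, f1]
  · rw [u2 c hca]
    by_cases hcb : c = b
    · subst hcb
      rw [v1, g1, Multiset.map_add, fv, fv]
      congr 1
      simp only [Multiset.map_singleton, sh]
      congr 2
      ring
    · rw [v2 c hcb, g2 c hcb, f2 c hca]

/-- General commutation at a single color. -/
theorem commute_gen {A : I → I → ℤ} (hA : IsBorcherdsCartan A) {ν : RCraw I} (hν : Ok ν) {a : I}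
    {l m : ℕ} {r s : ℤ} {R : Multiset (ℕ × ℤ)}
    (hl : Sel Prod.snd (ν a) l r) (hm : Sel (cor A ν a) (ν a) m s)
    (hR : ν a = rowm l r + (rowm m s + R))
    (h1 : r ≤ s + (vac A ν a (m + 1) - vac A ν a m) - A a a / 2)
    (h1' : r = s + (vac A ν a (m + 1) - vac A ν a m) - A a a / 2 → m + 1 ≤ l)
    (h2 : vac A ν a m - s ≤ vac A ν a (l + 1) - r - A a a / 2)
    (h2' : vac A ν a m - s = vac A ν a (l + 1) - r - A a a / 2 → l + 1 ≤ m) :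
    fOp A a (fStar A a ν) = fStar A a (fOp A a ν) := by
  have hR2 : ν a = rowm m s + (rowm l r + R) := by rw [hR]; abel
  obtain ⟨h, hh1, hh2⟩ := hA.half a
  obtain ⟨f1, f2⟩ := fOp_self A (hν.pos a) hl hR
  obtain ⟨g1, g2⟩ := fStar_self hA (hν.pos a) hm hR2
  have fv := fOp_vac (A := A) hν hl
  have gv := fStar_vac hA hν hm
  have hsub : ∀ q, q ∈ rowm l r + R → q ∈ ν a := by
    intro q hq; rw [hR2]; exact Multiset.mem_add.2 (Or.inr hq)
  have hsub2 : ∀ q, q ∈ rowm m s + R → q ∈ ν a := by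
    intro q hq; rw [hR]; exact Multiset.mem_add.2 (Or.inr hq)
  -- selection after fStar
  have hs1 : Sel Prod.snd (fStar A a ν a) l r := by
    rw [g1]
    refine ⟨?_, ?_, ?_⟩
    · by_cases h0 : l = 0
      · subst h0
        left; rw [hl.zero (hν.pos a)]
      · right
        simp [rowm, h0]
    · rintro q (rfl | hq)
      · exact hl.le _ (Or.inl rfl)
      · rcases Multiset.mem_add.1 hq with hq | hq
        · exact hl.le _ (Or.inr (hsub q hq))
        · rw [Multiset.mem_singleton.1 hq]; exact h1
    · rintro q (rfl | hq) he
      · simp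
      · rcases Multiset.mem_add.1 hq with hq | hq
        · exact hl.len _ (Or.inr (hsub q hq)) he
        · rw [Multiset.mem_singleton.1 hq] at he ⊢; exact h1' he.symm
  have hR1 : fStar A a ν a = rowm l r +
      (R + {(m + 1, s + (vac A ν a (m + 1) - vac A ν a m) - A a a / 2)}) := by
    rw [g1]; abel
  obtain ⟨u1, u2⟩ := fOp_self A ((fStar_ok hA hν).pos a) hs1 hR1
  -- selection after fOp
  have hcor : ∀ q, cor A (fOp A a ν) a (sh l (A a a) q) = cor A ν a q := by
    intro q
    simp only [cor, fv, sh]; ring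
  have hz : sh l (A a a) (0, 0) = (0, 0) := by simp [sh]
  have hs2 : Sel (cor A (fOp A a ν) a) (fOp A a ν a) m (sh l (A a a) (m, s)).2 := by
    have hm' := hcor (m, s)
    have e : (m, (sh l (A a a) (m, s)).2) = sh l (A a a) (m, s) := rfl
    have hnew : cor A (fOp A a ν) a (l + 1, r - A a a / 2) = vac A ν a (l + 1) - r - A a a / 2 := by
      simp only [cor, fv]; rw [hh2, hh1]; simp; ring
    rw [f1]
    refine ⟨?_, ?_, ?_⟩
    · rw [e]
      by_cases h0 : m = 0
      · subst h0
        left; rw [hm.zero (hν.pos a), hz]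
      · right
        apply Multiset.mem_add.2; left
        apply Multiset.mem_map_of_mem
        simp [rowm, h0]
    · rw [e, hm']
      rintro q (rfl | hq)
      · have := hcor (0, 0)
        rw [hz] at this
        rw [this]
        exact hm.le _ (Or.inl rfl)
      · rcases Multiset.mem_add.1 hq with hq | hq
        · obtain ⟨q', hq', rfl⟩ := Multiset.mem_map.1 hq
          rw [hcor]
          exact hm.le _ (Or.inr (hsub2 _ hq'))
        · rw [Multiset.mem_singleton.1 hq, hnew]; exact h2
    · rw [e, hm']
      rintro q (rfl | hq)
      · simp
      · rcases Multiset.mem_add.1 hq with hq | hq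
        · obtain ⟨q', hq', rfl⟩ := Multiset.mem_map.1 hq
          rw [hcor]
          exact hm.len _ (Or.inr (hsub2 _ hq'))
        · rw [Multiset.mem_singleton.1 hq, hnew]
          intro he; exact h2' he.symm
  have hT' : fOp A a ν a = rowm m (sh l (A a a) (m, s)).2 +
      (R.map (sh l (A a a)) + {(l + 1, r - A a a / 2)}) := by
    rw [f1, Multiset.map_add, add_assoc]
    congr 1
    unfold rowm
    split_ifs <;> simp [sh]
  obtain ⟨v1, v2⟩ := fStar_self hA ((fOp_ok (A := A) (a := a) hν).pos a) hs2 hT'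
  funext c
  by_cases hc : c = a
  · subst hc
    rw [u1, v1, Multiset.map_add, add_assoc, add_assoc, fv, fv]
    congr 1
    rw [add_comm]
    congr 1
    simp only [Multiset.map_singleton, sh]
    congr 2
    ring
  · rw [u2 c hc, v2 c hc, g2 c hc, f2 c hc]

theorem second_eq {A : I → I → ℤ} (hA : IsBorcherdsCartan A) {ν : RCraw I} (hν : Ok ν) {a : I}
    (ha : A a a = 2) {m k : ℕ} {s t : ℤ} {T : Multiset (ℕ × ℤ)}
    (hm : Sel (cor A ν a) (ν a) m s) (hT : ν a = rowm m s + T)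
    (hmem : (k, t) ∈ T ∨ (k, t) = (m + 1, s + (vac A ν a (m + 1) - vac A ν a m) - 1))
    (hmk : m + 1 ≤ k) (hrow : ∀ q ∈ T, q.1 ≤ k)
    (hn : ∀ b, b ≠ a → A b a ≠ 0 → ∀ q ∈ ν b, q.1 ≤ k)
    (hr0 : t ≤ 0) (hrT : ∀ q ∈ T, t ≤ q.2)
    (hrn : t ≤ s + (vac A ν a (m + 1) - vac A ν a m) - 1)
    (hcT : ∀ q ∈ T, vac A ν a k - 2 - t ≤ vac A ν a q.1 - (if m < q.1 then 2 else 0) - q.2)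
    (hc0 : vac A ν a k - 2 - t ≤ 0)
    (hcn : vac A ν a k - 2 - t ≤ vac A ν a m - s - 1)
    (hD : vac A ν a (k + 1) = vac A ν a k) :
    fOp A a (fStar A a ν) = fStar A a (fStar A a ν) := by
  obtain ⟨g1, g2⟩ := fStar_self hA (hν.pos a) hm hT
  have gv := fStar_vac hA hν hm
  have h2 : A a a / 2 = 1 := by rw [ha]; rfl
  rw [h2] at g1
  have hmem' : VV (fStar A a ν a) (k, t) := by
    right; rw [g1]
    apply Multiset.mem_add.2
    rcases hmem with h | h
    · left; exact h
    · right; rw [h]; simp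
  have hlen : ∀ q, VV (fStar A a ν a) q → q.1 ≤ k := by
    rintro q (rfl | hq)
    · simp
    · rw [g1] at hq
      rcases Multiset.mem_add.1 hq with hq | hq
      · exact hrow q hq
      · rw [Multiset.mem_singleton.1 hq]; exact hmk
  have hck : cor A (fStar A a ν) a (k, t) = vac A ν a k - 2 - t := by
    simp only [cor, gv, ha]
    rw [if_pos (by omega)]
  apply f_eq_fStar hA (fStar_ok hA hν) (a := a) (l := k) (r := t)
  · refine ⟨hmem', ?_, fun q hq _ => hlen q hq⟩
    rintro q (rfl | hq)
    · exact hr0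
    · rw [g1] at hq
      rcases Multiset.mem_add.1 hq with hq | hq
      · exact hrT q hq
      · rw [Multiset.mem_singleton.1 hq]; exact hrn
  · refine ⟨hmem', ?_, fun q hq _ => hlen q hq⟩
    rw [hck]
    rintro q (rfl | hq)
    · simpa [cor, vac_zero] using hc0
    · rw [g1] at hq
      rcases Multiset.mem_add.1 hq with hq | hq
      · simp only [cor, gv, ha]
        exact hcT q hq
      · rw [Multiset.mem_singleton.1 hq]
        simp only [cor, gv, ha]
        rw [if_pos (by omega)]
        omega
  · rw [gv, gv, hD, if_pos (by omega), if_pos (by omega)]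
  · intro _ q hq
    exact hlen q (Or.inr hq)
  · intro b hb
    rw [g2 b hb]
    exact hn b hb

theorem real_k0 {A : I → I → ℤ} (hA : IsBorcherdsCartan A) {ν : RCraw I} (hν : Ok ν) {a : I}
    {l m : ℕ} {r s : ℤ}
    (hl : Sel Prod.snd (ν a) l r) (hm : Sel (cor A ν a) (ν a) m s)
    (hc : vac A ν a (m + 1) ≤ r + (vac A ν a m - s)) :
    l = m ∧ r = s ∧ (∀ q ∈ ν a, q.1 ≤ m) ∧ (∀ k, vac A ν a (m + k) = vac A ν a m) ∧
      ∀ b, b ≠ a → A b a ≠ 0 → ∀ q ∈ ν b, q.1 ≤ m := by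
  have hrs : r ≤ s := hl.le _ hm.mem
  obtain ⟨h1, h2, h3⟩ := right_flat hA hν (a := a) (u := m) (c := r + (vac A ν a m - s))
    (by omega) hc (by
      intro q hq hlt
      have e1 : r ≤ q.2 := hl.le q (Or.inr hq)
      have e2 : vac A ν a m - s ≤ vac A ν a q.1 - q.2 := hm.le q (Or.inr hq)
      by_contra hcon
      have : q.1 ≤ m := hm.len q (Or.inr hq) (by simp only [cor]; omega)
      omega)
  have := h2 1
  have hs : r = s := by omega
  have hml : m ≤ l := hl.len _ hm.mem hs.symm
  have hlm : l ≤ m := by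
    rcases hl.mem with h | h
    · simp at h; omega
    · exact h1 _ h
  exact ⟨by omega, hs, h1, h2, h3⟩

theorem real_eq {A : I → I → ℤ} (hA : IsBorcherdsCartan A) {ν : RCraw I} (hν : Ok ν) {a : I}
    {l m : ℕ} {r s : ℤ}
    (hl : Sel Prod.snd (ν a) l r) (hm : Sel (cor A ν a) (ν a) m s)
    (hc : vac A ν a (m + 1) ≤ r + (vac A ν a m - s)) : fOp A a ν = fStar A a ν := by
  obtain ⟨rfl, rfl, h1, h2, h3⟩ := real_k0 hA hν hl hm hc
  exact f_eq_fStar hA hν hl hm (h2 1) (fun _ => h1) h3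

theorem decomp2 {M : Multiset (ℕ × ℤ)} {l m : ℕ} {r s : ℤ} (h1 : VV M (l, r)) (h2 : VV M (m, s))
    (hne : (l, r) ≠ (m, s) ∨ l = 0) : ∃ R, M = rowm l r + (rowm m s + R) := by
  obtain ⟨R, hR⟩ := h1.decomp
  have : VV R (m, s) := by
    rcases h2 with h2 | h2
    · left; exact h2
    · rw [hR] at h2
      rcases Multiset.mem_add.1 h2 with h2 | h2
      · rw [mem_rowm] at h2
        rcases hne with h | h
        · exact absurd h2.2.symm h
        · exact absurd h h2.1
      · right; exact h2
  obtain ⟨T, hT⟩ := this.decomp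
  exact ⟨T, by rw [hR, hT]⟩

set_option maxHeartbeats 1000000 in
theorem same_A {A : I → I → ℤ} (hA : IsBorcherdsCartan A) {ν : RCraw I} (hν : Ok ν) {a : I}
    {l : ℕ} {r : ℤ} {T : Multiset (ℕ × ℤ)} (ha : A a a = 2)
    (hl : Sel Prod.snd (ν a) l r) (hm : Sel (cor A ν a) (ν a) l r)
    (hT : ν a = rowm l r + T) (hc : vac A ν a l < vac A ν a (l + 1))
    (h3a : vac A ν a (l + 1) = vac A ν a l + 1) (hrow : ∀ q ∈ ν a, q.1 ≠ l + 1)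
    (e : vac A ν a (l + 2) - vac A ν a (l + 1) = vac A ν a (l + 1) - vac A ν a l)
    (hn : ∀ b, b ≠ a → A b a ≠ 0 → ∀ q ∈ ν b, q.1 ≠ l + 1) :
    fOp A a (fStar A a ν) = fStar A a (fOp A a ν) := by
  have half : A a a / 2 = 1 := by rw [ha]; rfl
  have p0 := vac_zero A ν a
  have F1 : ∀ q, VV (ν a) q → r ≤ q.2 := hl.le
  have F2 : ∀ q, VV (ν a) q → vac A ν a l - r ≤ vac A ν a q.1 - q.2 := hm.le
  have F3 : ∀ q, VV (ν a) q → q.2 = r → q.1 ≤ l := hl.len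
  have F4 : ∀ q, VV (ν a) q → vac A ν a q.1 - q.2 = vac A ν a l - r → q.1 ≤ l := hm.len
  have r0 : r ≤ 0 := F1 (0, 0) (Or.inl rfl)
  have y0 : vac A ν a l - r ≤ 0 := by have := F2 (0, 0) (Or.inl rfl); simp only [p0] at this; omega
  have hTs : ∀ q ∈ T, VV (ν a) q := by
    intro q hq; right; rw [hT]; exact Multiset.mem_add.2 (Or.inr hq)
  obtain ⟨f1, f2⟩ := fOp_self A (hν.pos a) hl hT
  obtain ⟨g1, g2⟩ := fStar_self hA (hν.pos a) hm hT
  have fv := fOp_vac (A := A) hν hl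
  have gv := fStar_vac hA hν hm
  have hcor : ∀ q, cor A (fOp A a ν) a (sh l (A a a) q) = cor A ν a q := by
    intro q
    simp only [cor, fv, sh]; ring
  have hz : sh l (A a a) (0, 0) = (0, 0) := by simp [sh]
  rw [half] at f1 g1
  have hs1 : Sel Prod.snd (fStar A a ν a) (l + 1) r := by
    rw [g1, h3a]
    refine ⟨?_, ?_, ?_⟩
    · right
      apply Multiset.mem_add.2; right
      rw [Multiset.mem_singleton]; congr 1; omega
    · rintro q (rfl | hq)
      · exact r0
      · rcases Multiset.mem_add.1 hq with hq | hq
        · exact F1 _ (hTs q hq)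
        · rw [Multiset.mem_singleton.1 hq]; simp only; omega
    · rintro q (rfl | hq) he
      · simp
      · rcases Multiset.mem_add.1 hq with hq | hq
        · have := F3 _ (hTs q hq) he; omega
        · rw [Multiset.mem_singleton.1 hq]
  have hR1 : fStar A a ν a = rowm (l + 1) r + T := by
    rw [g1, h3a, add_comm]
    congr 1
    simp only [rowm]
    rw [if_neg (by omega)]
    congr 2; omega
  obtain ⟨u1, u2⟩ := fOp_self A ((fStar_ok hA hν).pos a) hs1 hR1
  have hnew : cor A (fOp A a ν) a (l + 1, r - 1) = cor A ν a (l, r) := by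
    simp only [cor, fv, ha, h3a]; simp; ring
  have hs2 : Sel (cor A (fOp A a ν) a) (fOp A a ν a) (l + 1) (r - 1) := by
    rw [f1]
    refine ⟨?_, ?_, ?_⟩
    · right
      apply Multiset.mem_add.2; right
      simp
    · rw [hnew]
      rintro q (rfl | hq)
      · have := hcor (0, 0)
        rw [hz] at this
        rw [this]
        exact hm.le _ (Or.inl rfl)
      · rcases Multiset.mem_add.1 hq with hq | hq
        · obtain ⟨q', hq', rfl⟩ := Multiset.mem_map.1 hq
          rw [hcor]
          exact hm.le _ (hTs _ hq')
        · rw [Multiset.mem_singleton.1 hq, hnew]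
    · rw [hnew]
      rintro q (rfl | hq)
      · simp
      · rcases Multiset.mem_add.1 hq with hq | hq
        · obtain ⟨q', hq', rfl⟩ := Multiset.mem_map.1 hq
          rw [hcor]
          intro h
          have : q'.1 ≤ l := hm.len _ (hTs _ hq') h
          simp only [sh]; omega
        · rw [Multiset.mem_singleton.1 hq]; simp
  have hT2 : fOp A a ν a = rowm (l + 1) (r - 1) + T.map (sh l (A a a)) := by
    rw [f1, add_comm]
    congr 1
  obtain ⟨v1, v2⟩ := fStar_self hA ((fOp_ok (A := A) (a := a) hν).pos a) hs2 hT2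
  funext c
  by_cases hca : c = a
  · subst hca
    rw [u1, v1, half, fv, fv]
    congr 1
    · apply map_sh_congr
      intro _ q hq
      have : q.1 ≠ l + 1 := by
        rcases hTs q hq with rfl | h
        · simp
        · exact hrow q h
      omega
    · congr 2
      rw [if_pos (by omega), if_pos (by omega)]
      rw [show l + 1 + 1 = l + 2 by ring]
      omega
  · rw [u2 c hca, v2 c hca, g2 c hca, f2 c hca]
    apply map_sh_congr
    intro hk q hq
    have := hn c hca hk q hq
    omega

set_option maxHeartbeats 1000000 in
theorem same_B {A : I → I → ℤ} (hA : IsBorcherdsCartan A) {ν : RCraw I} (hν : Ok ν) {a : I}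
    {l : ℕ} {r : ℤ} {T : Multiset (ℕ × ℤ)} (ha : A a a = 2)
    (hl : Sel Prod.snd (ν a) l r) (hm : Sel (cor A ν a) (ν a) l r)
    (hT : ν a = rowm l r + T) (hc : vac A ν a l < vac A ν a (l + 1))
    (hcopy : ¬ VV T (l, r)) (hc2 : vac A ν a l + 2 ≤ vac A ν a (l + 1)) :
    fOp A a (fStar A a ν) = fStar A a (fOp A a ν) := by
  have half : A a a / 2 = 1 := by rw [ha]; rfl
  have p0 := vac_zero A ν a
  have F1 : ∀ q, VV (ν a) q → r ≤ q.2 := hl.le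
  have F2 : ∀ q, VV (ν a) q → vac A ν a l - r ≤ vac A ν a q.1 - q.2 := hm.le
  have F3 : ∀ q, VV (ν a) q → q.2 = r → q.1 ≤ l := hl.len
  have F4 : ∀ q, VV (ν a) q → vac A ν a q.1 - q.2 = vac A ν a l - r → q.1 ≤ l := hm.len
  have r0 : r ≤ 0 := F1 (0, 0) (Or.inl rfl)
  have y0 : vac A ν a l - r ≤ 0 := by have := F2 (0, 0) (Or.inl rfl); simp only [p0] at this; omega
  have hTs : ∀ q ∈ T, VV (ν a) q := by
    intro q hq; right; rw [hT]; exact Multiset.mem_add.2 (Or.inr hq)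
  obtain ⟨f1, f2⟩ := fOp_self A (hν.pos a) hl hT
  obtain ⟨g1, g2⟩ := fStar_self hA (hν.pos a) hm hT
  have fv := fOp_vac (A := A) hν hl
  have gv := fStar_vac hA hν hm
  have hcor : ∀ q, cor A (fOp A a ν) a (sh l (A a a) q) = cor A ν a q := by
    intro q
    simp only [cor, fv, sh]; ring
  have hz : sh l (A a a) (0, 0) = (0, 0) := by simp [sh]
  rw [half] at f1 g1
  have hl0 : l ≠ 0 := by
    intro h
    subst h
    exact hcopy (Or.inl (by rw [hl.zero (hν.pos a)]))
  have hTl : ∀ q ∈ T, q.1 ≠ l := by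
    intro q hq hlq
    have e1 := F1 q (hTs q hq)
    have e2 := F2 q (hTs q hq)
    rw [hlq] at e2
    apply hcopy
    right
    have : q = (l, r) := by
      apply Prod.ext
      · exact hlq
      · simp only; omega
    rw [← this]; exact hq
  obtain ⟨k, rfl⟩ : ∃ k, l = k + 1 := ⟨l - 1, by omega⟩
  have hcount : eqc (ν a) (k + 1) = 1 := by
    have h0 : eqc T (k + 1) = 0 := eqc_eq_zero.2 hTl
    have : eqc (ν a) (k + 1) = eqc T (k + 1) + 1 := by
      rw [hT]
      simp [eqc, rowm]
    omega
  obtain ⟨N, hN, e, hn⟩ := vac_conc hA hν a k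
  rw [hcount, ha] at e
  rw [show k + 1 + 1 = k + 2 by ring] at *
  have hge : ∀ q, VV (ν a) q → vac A ν a (k + 1) ≤ vac A ν a q.1 := by
    intro q hq
    have := F1 q hq
    have := F2 q hq
    omega
  have hc0 : vac A ν a (k + 1) ≤ 0 := by
    have := hge (0, 0) (Or.inl rfl)
    simp only [p0] at this; exact this
  have hk : ¬ vac A ν a k < vac A ν a (k + 1) := by
    intro hlt
    exact core_left hA hν (a := a) (v := k + 1) (c := vac A ν a (k + 1) - 1) (by omega)
      (fun q hq _ => by have := hge q (Or.inr hq); omega) k (by omega) (by omega) (by omega)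
  have hk1 : vac A ν a k = vac A ν a (k + 1) := by omega
  have hk2 : vac A ν a (k + 2) = vac A ν a (k + 1) + 2 := by omega
  obtain ⟨i, hi, p1, p2, p3, p4, p5⟩ := flat_left hA hν (a := a) (v := k + 1)
    (c := vac A ν a (k + 1)) hc0 (fun q hq _ => hge q (Or.inr hq)) k (by omega) hk1 rfl
  have hiV : VV T (i, r) := by
    rcases p3 with rfl | ⟨r', hr'⟩
    · left
      rw [p0] at p1
      congr 1; omega
    · have e1 := F1 _ (Or.inr hr')
      have e2 := F2 _ (Or.inr hr')
      simp only at e1 e2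
      have : r' = r := by omega
      subst this
      rw [hT] at hr'
      rcases Multiset.mem_add.1 hr' with h | h
      · rw [mem_rowm] at h; simp at h; omega
      · right; exact h
  obtain ⟨R, hR⟩ := hiV.decomp
  have hRT : ∀ q ∈ R, q ∈ T := by
    intro q hq; rw [hR]; exact Multiset.mem_add.2 (Or.inr hq)
  have hlenT : ∀ q ∈ T, q.1 ≤ k + 1 → q.1 ≤ i := by
    intro q hq hle
    have h1 := hTl q hq
    by_contra hcon
    rcases hTs q hq with rfl | h
    · simp at hcon
    · exact p4 q h (by omega) (by omega)
  have hs1 : Sel Prod.snd (fStar A a ν a) i r := by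
    rw [g1, hk2]
    refine ⟨?_, ?_, ?_⟩
    · rcases hiV with h | h
      · left; exact h
      · right; exact Multiset.mem_add.2 (Or.inl h)
    · rintro q (rfl | hq)
      · exact r0
      · rcases Multiset.mem_add.1 hq with hq | hq
        · exact F1 _ (hTs q hq)
        · rw [Multiset.mem_singleton.1 hq]; simp only; omega
    · rintro q (rfl | hq) he
      · simp
      · rcases Multiset.mem_add.1 hq with hq | hq
        · exact hlenT q hq (F3 _ (hTs q hq) he)
        · rw [Multiset.mem_singleton.1 hq] at he
          simp only at he; omega
  have hR1 : fStar A a ν a = rowm i r + (R + {(k + 2, r + 1)}) := by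
    rw [g1, hR, add_assoc]
    congr 4
    omega
  obtain ⟨u1, u2⟩ := fOp_self A ((fStar_ok hA hν).pos a) hs1 hR1
  have hnew : cor A (fOp A a ν) a (k + 2, r - 1) = cor A ν a (k + 1, r) + 1 := by
    simp only [cor, fv, ha, hk2]; simp; ring
  have hir : sh (k + 1) (A a a) (i, r) = (i, r) := by
    simp only [sh]; rw [if_neg (by omega)]; simp
  have hcir : cor A (fOp A a ν) a (i, r) = cor A ν a (k + 1, r) := by
    rw [← hir, hcor]
    simp only [cor, p1]
  have hs2 : Sel (cor A (fOp A a ν) a) (fOp A a ν a) i r := by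
    rw [f1]
    refine ⟨?_, ?_, ?_⟩
    · rcases hiV with h | h
      · left; exact h
      · right
        apply Multiset.mem_add.2; left
        rw [← hir]
        exact Multiset.mem_map_of_mem _ h
    · rw [hcir]
      rintro q (rfl | hq)
      · have := hcor (0, 0)
        rw [hz] at this
        rw [this]
        exact hm.le _ (Or.inl rfl)
      · rcases Multiset.mem_add.1 hq with hq | hq
        · obtain ⟨q', hq', rfl⟩ := Multiset.mem_map.1 hq
          rw [hcor]
          exact hm.le _ (hTs _ hq')
        · rw [Multiset.mem_singleton.1 hq, hnew]; omega
    · rw [hcir]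
      rintro q (rfl | hq)
      · simp
      · rcases Multiset.mem_add.1 hq with hq | hq
        · obtain ⟨q', hq', rfl⟩ := Multiset.mem_map.1 hq
          rw [hcor]
          intro h
          exact hlenT q' hq' (hm.len _ (hTs _ hq') h)
        · rw [Multiset.mem_singleton.1 hq, hnew]; omega
  have hT2 : fOp A a ν a = rowm i r + (R.map (sh (k + 1) (A a a)) + {(k + 2, r - 1)}) := by
    rw [f1, hR, Multiset.map_add, add_assoc]
    congr 1
    unfold rowm
    split_ifs
    · rfl
    · simp only [Multiset.map_singleton, hir]
  obtain ⟨v1, v2⟩ := fStar_self hA ((fOp_ok (A := A) (a := a) hν).pos a) hs2 hT2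
  funext c
  by_cases hca : c = a
  · subst hca
    rw [u1, v1, half, fv, fv, p2, p1, if_neg (by omega), if_neg (by omega),
      Multiset.map_add]
    congr 1
    · congr 1
      · apply map_sh_congr
        intro _ q hq
        have := hlenT q (hRT q hq)
        omega
      · simp only [Multiset.map_singleton, sh, ha]
        congr 2
        rw [if_pos (by omega)]; ring
    · congr 2; ring
  · rw [u2 c hca, v2 c hca, g2 c hca, f2 c hca]
    apply map_sh_congr
    intro hk q hq
    have h1 := hn (by omega) c hca hk q hq
    have h2 := p5 c hca hk q hq
    by_contra hcon
    exact h2 (by omega) (by omega)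

set_option maxHeartbeats 1000000 in
theorem same_C {A : I → I → ℤ} (hA : IsBorcherdsCartan A) {ν : RCraw I} (hν : Ok ν) {a : I}
    {l : ℕ} {r : ℤ} {T : Multiset (ℕ × ℤ)} (ha : A a a = 2)
    (hl : Sel Prod.snd (ν a) l r) (hm : Sel (cor A ν a) (ν a) l r)
    (hT : ν a = rowm l r + T) (hc : vac A ν a l < vac A ν a (l + 1)) :
    fOp A a (fStar A a ν) = fStar A a (fOp A a ν) ∨
    fOp A a (fStar A a ν) = fStar A a (fStar A a ν) := by
  have half : A a a / 2 = 1 := by rw [ha]; rfl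
  have p0 := vac_zero A ν a
  have F1 : ∀ q, VV (ν a) q → r ≤ q.2 := hl.le
  have F2 : ∀ q, VV (ν a) q → vac A ν a l - r ≤ vac A ν a q.1 - q.2 := hm.le
  have F3 : ∀ q, VV (ν a) q → q.2 = r → q.1 ≤ l := hl.len
  have F4 : ∀ q, VV (ν a) q → vac A ν a q.1 - q.2 = vac A ν a l - r → q.1 ≤ l := hm.len
  have r0 : r ≤ 0 := F1 (0, 0) (Or.inl rfl)
  have y0 : vac A ν a l - r ≤ 0 := by have := F2 (0, 0) (Or.inl rfl); simp only [p0] at this; omega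
  have hTs : ∀ q ∈ T, VV (ν a) q := by
    intro q hq; right; rw [hT]; exact Multiset.mem_add.2 (Or.inr hq)
  have hstrict : ∀ q ∈ ν a, l < q.1 → vac A ν a l + 2 ≤ vac A ν a q.1 := by
    intro q hq hlt
    have e1 := F1 q (Or.inr hq)
    have e2 := F2 q (Or.inr hq)
    by_contra hcon
    have e3 := F3 q (Or.inr hq)
    have e4 := F4 q (Or.inr hq)
    have : q.2 ≠ r := fun h => by have := e3 h; omega
    have : vac A ν a q.1 - q.2 ≠ vac A ν a l - r := fun h => by have := e4 h; omega
    omega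
  by_cases h3a : vac A ν a (l + 1) = vac A ν a l + 1
  · obtain ⟨N, hN, e, hn⟩ := vac_conc hA hν a l
    have hrow : ∀ q ∈ ν a, q.1 ≠ l + 1 := by
      intro q hq hlq
      have := hstrict q hq (by omega)
      rw [hlq] at this
      omega
    rw [eqc_eq_zero.2 hrow, mul_zero] at e
    by_cases hN0 : N = 0
    · left
      exact same_A hA hν ha hl hm hT hc h3a hrow (by omega) (hn hN0)
    · right
      obtain ⟨h1, h2, h3⟩ := right_flat hA hν (a := a) (u := l + 1) (c := vac A ν a l + 1)
        (by rw [show l + 1 + 1 = l + 2 by ring]; omega)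
        (by rw [show l + 1 + 1 = l + 2 by ring]; omega) (by
          intro q hq hlt
          have := hstrict q hq (by omega)
          omega)
      have hrow' : ∀ q ∈ T, q.1 ≤ l := by
        intro q hq
        rcases hTs q hq with rfl | h
        · simp
        · have := h1 q h
          have := hrow q h
          omega
      refine second_eq hA hν ha hm hT (k := l + 1) (t := r)
        (Or.inr (by congr 1; omega)) le_rfl
        (fun q hq => (hrow' q hq).trans (by omega)) h3 (by omega)
        (fun q hq => F1 q (hTs q hq)) (by omega) (fun q hq => ?_) (by omega) (by omega) (h2 1)
      have := F2 q (hTs q hq)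
      have := hrow' q hq
      rw [if_neg (by omega)]
      omega
  · left
    by_cases hcopy : VV T (l, r)
    · obtain ⟨R, hR⟩ := hcopy.decomp
      refine commute_gen hA hν hl hm (R := R) (by rw [hT, hR]) (by omega) (fun h => ?_) (by omega)
        (fun h => ?_) <;> omega
    · exact same_B hA hν ha hl hm hT hc hcopy (by omega)

set_option maxHeartbeats 1000000 in
theorem real_commute {A : I → I → ℤ} (hA : IsBorcherdsCartan A) {ν : RCraw I} (hν : Ok ν) {a : I}
    (ha : A a a = 2) :
    fOp A a (fStar A a ν) = fStar A a (fOp A a ν) ∨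
    fOp A a (fStar A a ν) = fStar A a (fStar A a ν) := by
  obtain ⟨l, r, hl⟩ := exists_sel Prod.snd (ν a)
  obtain ⟨m, s, hm⟩ := exists_sel (cor A ν a) (ν a)
  have half : A a a / 2 = 1 := by rw [ha]; rfl
  have p0 := vac_zero A ν a
  have F1 : ∀ q, VV (ν a) q → r ≤ q.2 := hl.le
  have F2 : ∀ q, VV (ν a) q → vac A ν a m - s ≤ vac A ν a q.1 - q.2 := hm.le
  have F3 : ∀ q, VV (ν a) q → q.2 = r → q.1 ≤ l := hl.len
  have F4 : ∀ q, VV (ν a) q → vac A ν a q.1 - q.2 = vac A ν a m - s → q.1 ≤ m := hm.len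
  have r0 : r ≤ 0 := F1 (0, 0) (Or.inl rfl)
  have y0 : vac A ν a m - s ≤ 0 := by have := F2 (0, 0) (Or.inl rfl); simp only [p0] at this; omega
  have rs : r ≤ s := F1 (m, s) hm.mem
  have yl : vac A ν a m - s ≤ vac A ν a l - r := F2 (l, r) hl.mem
  obtain ⟨T, hT⟩ := hm.mem.decomp
  have hTs : ∀ q ∈ T, VV (ν a) q := by
    intro q hq; right; rw [hT]; exact Multiset.mem_add.2 (Or.inr hq)
  -- case 0
  by_cases hc : vac A ν a (m + 1) ≤ r + (vac A ν a m - s)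
  · right
    obtain ⟨rfl, rfl, h1, h2, h3⟩ := real_k0 hA hν hl hm hc
    have e1 := h2 1
    have e2 := h2 2
    have e3 : vac A ν a (l + 1 + 1) = vac A ν a (l + 1) := by
      rw [show l + 1 + 1 = l + 2 by ring, e2, e1]
    have g1 : (l + 1, r - 1) = (l + 1, r + (vac A ν a (l + 1) - vac A ν a l) - 1) := by
      rw [e1, sub_self, add_zero]
    have g2 : ∀ q ∈ T, q.1 ≤ l + 1 := by
      intro q hq
      rcases hTs q hq with rfl | h
      · simp
      · exact (h1 q h).trans (by omega)
    have g3 : ∀ q ∈ T, r - 1 ≤ q.2 := fun q hq => by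
      have := F1 q (hTs q hq); omega
    have g4 : ∀ q ∈ T, vac A ν a (l + 1) - 2 - (r - 1) ≤
        vac A ν a q.1 - (if l < q.1 then 2 else 0) - q.2 := fun q hq => by
      have := F2 q (hTs q hq)
      have hq1 : q.1 ≤ l := by
        rcases hTs q hq with rfl | h
        · simp
        · exact h1 q h
      rw [if_neg (by omega)]
      omega
    exact second_eq hA hν ha hm hT (k := l + 1) (t := r - 1) (Or.inr g1) le_rfl
      g2 (fun b hb hne q hq => (h3 b hb hne q hq).trans (by omega)) (by omega)
      g3 (by omega) g4 (by omega) (by omega) e3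
  -- case 0'
  by_cases hc' : vac A ν a (l + 1) ≤ r + (vac A ν a m - s)
  · exfalso
    obtain ⟨h1, h2, h3⟩ := right_flat hA hν (a := a) (u := l) (c := r + (vac A ν a m - s))
      (by omega) hc' (by
        intro q hq hlt
        have e1 := F1 q (Or.inr hq)
        have e2 := F2 q (Or.inr hq)
        by_contra hcon
        have := F3 q (Or.inr hq) (by omega)
        omega)
    have := h2 1
    have hlm : l ≤ m := F4 (l, r) hl.mem (by simp only; omega)
    have hml : m ≤ l := by
      rcases hm.mem with h | h
      · simp at h; omega
      · exact h1 _ h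
    have : l = m := by omega
    subst this
    omega
  -- step 1
  by_cases hs1 : vac A ν a (m + 1) = r + (vac A ν a m - s) + 1 ∧ l ≤ m ∧ r < s
  · obtain ⟨q1, q2, q3⟩ := hs1
    right
    obtain ⟨h1, h2, h3⟩ := right_flat hA hν (a := a) (u := m) (c := r + (vac A ν a m - s) + 1)
      (by omega) (by omega) (by
        intro q hq hlt
        have e1 := F1 q (Or.inr hq)
        have e2 := F2 q (Or.inr hq)
        by_contra hcon
        have e3 := F3 q (Or.inr hq)
        have e4 := F4 q (Or.inr hq)
        have : q.2 ≠ r := fun h => by have := e3 h; omega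
        have : vac A ν a q.1 - q.2 ≠ vac A ν a m - s := fun h => by have := e4 h; omega
        omega)
    have e1 := h2 1
    have e2 := h2 2
    refine second_eq hA hν ha hm hT (k := m + 1) (t := r)
      (Or.inr (by congr 1; omega)) le_rfl
      (fun q hq => ?_) (fun b hb hne q hq => (h3 b hb hne q hq).trans (by omega)) (by omega)
      (fun q hq => ?_) (by omega) (fun q hq => ?_) (by omega) (by omega) ?_
    · rcases hTs q hq with rfl | h
      · simp
      · exact (h1 q h).trans (by omega)
    · have := F1 q (hTs q hq); omega
    · have := F2 q (hTs q hq)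
      have : q.1 ≤ m := by
        rcases hTs q hq with rfl | h
        · simp
        · exact h1 q h
      rw [if_neg (by omega)]
      omega
    · rw [show m + 1 + 1 = m + 2 by ring, e2, e1]
  -- step 1'
  by_cases hs2 : vac A ν a (l + 1) = r + (vac A ν a m - s) + 1 ∧ m ≤ l ∧
      vac A ν a m - s < vac A ν a l - r
  · obtain ⟨q1, q2, q3⟩ := hs2
    right
    obtain ⟨h1, h2, h3⟩ := right_flat hA hν (a := a) (u := l) (c := r + (vac A ν a m - s) + 1)
      (by omega) (by omega) (by
        intro q hq hlt
        have e1 := F1 q (Or.inr hq)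
        have e2 := F2 q (Or.inr hq)
        by_contra hcon
        have e3 := F3 q (Or.inr hq)
        have e4 := F4 q (Or.inr hq)
        have : q.2 ≠ r := fun h => by have := e3 h; omega
        have : vac A ν a q.1 - q.2 ≠ vac A ν a m - s := fun h => by have := e4 h; omega
        omega)
    have e1 := h2 1
    have hlm : m < l := by
      rcases Nat.lt_or_ge m l with h | h
      · exact h
      · exfalso
        have : l = m := by omega
        subst this
        exact hs1 ⟨by omega, le_rfl, by omega⟩
    have hmemT : (l, r) ∈ T := by
      rcases hl.mem with h | h
      · simp at h; omega
      · rw [hT] at h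
        rcases Multiset.mem_add.1 h with h | h
        · rw [mem_rowm] at h; simp at h; omega
        · exact h
    refine second_eq hA hν ha hm hT (k := l) (t := r) (Or.inl hmemT) (by omega)
      (fun q hq => ?_) (fun b hb hne q hq => (h3 b hb hne q hq)) (by omega)
      (fun q hq => ?_) (by omega) (fun q hq => ?_) (by omega) (by omega) e1
    · rcases hTs q hq with rfl | h
      · simp
      · exact h1 q h
    · have := F1 q (hTs q hq); omega
    · have := F2 q (hTs q hq)
      split_ifs with hlt
      · have : vac A ν a q.1 - q.2 ≠ vac A ν a m - s := fun h => by
          have := F4 q (hTs q hq) h; omega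
        omega
      · omega
  by_cases hne : (l, r) ≠ (m, s)
  · left
    obtain ⟨R, hR⟩ := decomp2 hl.mem hm.mem (Or.inl hne)
    refine commute_gen hA hν hl hm hR (by omega) (fun h => ?_) (by omega) (fun h => ?_)
    · by_contra hcon
      by_cases hrs : r < s
      · exact hs1 ⟨by omega, by omega, hrs⟩
      · have hrs : s = r := by omega
        have := F3 (m, s) hm.mem hrs
        simp only at this
        exact hne (by rw [hrs]; congr 1; omega)
    · by_contra hcon
      by_cases hrs : vac A ν a m - s < vac A ν a l - r
      · exact hs2 ⟨by omega, by omega, hrs⟩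
      · have := F4 (l, r) hl.mem (by simp only; omega)
        simp only at this
        have : l = m := by omega
        subst this
        exact hne (by congr 1; omega)
  · -- same row
    rw [not_not] at hne
    obtain ⟨rfl, rfl⟩ := Prod.mk.inj hne
    exact same_C hA hν ha hl hm hT (by omega)

/-! ### The imaginary case -/

/-- Lower bounds on riggings and coriggings at imaginary nodes. -/
structure W (A : I → I → ℤ) (ν : RCraw I) : Prop where
  ok : Ok ν
  rig : ∀ a, A a a ≤ 0 → ∀ q ∈ ν a, -(A a a / 2) ≤ q.2
  crig : ∀ a, A a a ≤ 0 → ∀ q ∈ ν a, -(A a a / 2) ≤ vac A ν a q.1 - q.2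

theorem vac_imag_mono {A : I → I → ℤ} (hA : IsBorcherdsCartan A) {ν : RCraw I} (hν : Ok ν) {a : I}
    (ha : A a a ≤ 0) (i : ℕ) : vac A ν a i ≤ vac A ν a (i + 1) := by
  obtain ⟨N, hN, e, _⟩ := vac_mono hA hν a i
  have h0 : 0 ≤ gtc (ν a) i := by simp [gtc]
  have := mul_nonneg (neg_nonneg.2 ha) h0
  linarith

theorem vac_imag_monotone {A : I → I → ℤ} (hA : IsBorcherdsCartan A) {ν : RCraw I} (hν : Ok ν)
    {a : I} (ha : A a a ≤ 0) : Monotone (vac A ν a) :=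
  monotone_nat_of_le_succ (vac_imag_mono hA hν ha)

theorem vac_imag_nonneg {A : I → I → ℤ} (hA : IsBorcherdsCartan A) {ν : RCraw I} (hν : Ok ν)
    {a : I} (ha : A a a ≤ 0) (i : ℕ) : 0 ≤ vac A ν a i := by
  have := vac_imag_monotone hA hν ha (Nat.zero_le i)
  rwa [vac_zero] at this

theorem W.sel_cor {A : I → I → ℤ} (hA : IsBorcherdsCartan A) {ν : RCraw I} (hν : W A ν) {a : I}
    (ha : A a a ≤ 0) {m : ℕ} {s : ℤ} (hm : Sel (cor A ν a) (ν a) m s) :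
    s = vac A ν a m ∧ (A a a < 0 → m = 0) := by
  obtain ⟨h, h1, h2⟩ := hA.half a
  have h0 : vac A ν a m - s ≤ vac A ν a 0 - 0 := hm.le (0, 0) (Or.inl rfl)
  rw [vac_zero] at h0
  rcases hm.mem with hmem | hmem
  · obtain ⟨rfl, rfl⟩ := Prod.mk.inj hmem
    rw [vac_zero]; simp
  · have h3 : -(A a a / 2) ≤ vac A ν a m - s := hν.crig a ha (m, s) hmem
    exact ⟨by omega, fun _ => by omega⟩

theorem W.sel_rig {A : I → I → ℤ} (hA : IsBorcherdsCartan A) {ν : RCraw I} (hν : W A ν) {a : I}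
    (ha : A a a ≤ 0) {l : ℕ} {r : ℤ} (hl : Sel Prod.snd (ν a) l r) :
    r = 0 ∧ (A a a < 0 → l = 0) := by
  obtain ⟨h, h1, h2⟩ := hA.half a
  have h0 : r ≤ 0 := hl.le (0, 0) (Or.inl rfl)
  rcases hl.mem with hmem | hmem
  · obtain ⟨rfl, rfl⟩ := Prod.mk.inj hmem
    simp
  · have h3 : -(A a a / 2) ≤ r := hν.rig a ha (l, r) hmem
    exact ⟨by omega, fun _ => by omega⟩

theorem W.fStar {A : I → I → ℤ} (hA : IsBorcherdsCartan A) {ν : RCraw I} (hν : W A ν) (b : I) :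
    W A (fStar A b ν) := by
  obtain ⟨m, s, hm⟩ := exists_sel (cor A ν b) (ν b)
  obtain ⟨T, hT⟩ := hm.mem.decomp
  obtain ⟨g1, g2⟩ := fStar_self hA (hν.ok.pos b) hm hT
  have gv := fStar_vac hA hν.ok hm
  have hTs : ∀ q ∈ T, q ∈ ν b := by
    intro q hq; rw [hT]; exact Multiset.mem_add.2 (Or.inr hq)
  have hoff : ∀ c i, A c c ≤ 0 → (if m < i then A c b else 0) ≤ 0 := by
    intro c i hc
    split_ifs
    · by_cases hcb : c = b
      · subst hcb; exact hc
      · exact hA.offdiag c b hcb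
    · exact le_rfl
  refine ⟨fStar_ok hA hν.ok, ?_, ?_⟩
  · intro c hc q hq
    by_cases hcb : c = b
    · subst hcb
      rw [g1] at hq
      rcases Multiset.mem_add.1 hq with hq | hq
      · exact hν.rig c hc q (hTs q hq)
      · rw [Multiset.mem_singleton.1 hq]
        have := (hν.sel_cor hA hc hm).1
        have := vac_imag_nonneg hA hν.ok hc (m + 1)
        simp only
        omega
    · rw [g2 c hcb] at hq
      exact hν.rig c hc q hq
  · intro c hc q hq
    have h1 := hoff c q.1 hc
    by_cases hcb : c = b
    · subst hcb
      rw [g1] at hq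
      rcases Multiset.mem_add.1 hq with hq | hq
      · have := hν.crig c hc q (hTs q hq)
        rw [gv]; omega
      · rw [Multiset.mem_singleton.1 hq, gv]
        have := (hν.sel_cor hA hc hm).1
        obtain ⟨h, h1, h2⟩ := hA.half c
        simp only [h1]
        rw [if_pos (by omega)]
        omega
    · rw [g2 c hcb] at hq
      have := hν.crig c hc q hq
      rw [gv]; omega

theorem W.theta {A : I → I → ℤ} {ν : RCraw I} (hν : W A ν) : W A (theta A ν) := by
  refine ⟨theta_ok hν.ok, ?_, ?_⟩
  · intro c hc q hq
    obtain ⟨q', hq', rfl⟩ := Multiset.mem_map.1 hq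
    exact hν.crig c hc q' hq'
  · intro c hc q hq
    obtain ⟨q', hq', rfl⟩ := Multiset.mem_map.1 hq
    rw [theta_vac]
    have := hν.rig c hc q' hq'
    simp only
    omega

theorem W.fOp {A : I → I → ℤ} (hA : IsBorcherdsCartan A) {ν : RCraw I} (hν : W A ν) (b : I) :
    W A (fOp A b ν) := by
  have h := (hν.theta.fStar hA b).theta
  rwa [theta_fStar hA (theta_ok hν.ok), theta_theta] at h

theorem Ok.empty : Ok (emptyRC : RCraw I) := by
  constructor
  · simp [emptyRC]
  · simp [emptyRC]

theorem W.empty (A : I → I → ℤ) : W A (emptyRC : RCraw I) := by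
  refine ⟨Ok.empty, ?_, ?_⟩ <;> simp [emptyRC]

theorem zero_flat {A : I → I → ℤ} (hA : IsBorcherdsCartan A) {ν : RCraw I} (hν : Ok ν)
    {a : I} (ha : A a a = 0) (h1 : vac A ν a 1 = 0) : ∀ i, vac A ν a i = 0 := by
  have key : ∀ i, vac A ν a i = 0 ∧ vac A ν a (i + 1) = 0 := by
    intro i
    induction i with
    | zero => exact ⟨vac_zero A ν a, h1⟩
    | succ i ih =>
      refine ⟨ih.2, ?_⟩
      obtain ⟨N, hN, e, _⟩ := vac_conc hA hν a i
      have := vac_imag_mono hA hν ha.le (i + 1)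
      rw [ha, zero_mul] at e
      rw [show i + 1 + 1 = i + 2 by ring] at *
      omega
  exact fun i => (key i).1

theorem imag_eq {A : I → I → ℤ} (hA : IsBorcherdsCartan A) {ν : RCraw I} (hν : W A ν)
    {a : I} (ha : A a a ≤ 0) (h1 : vac A ν a 1 = 0) : fOp A a ν = fStar A a ν := by
  obtain ⟨N, hN, e, hn⟩ := vac_mono hA hν.ok a 0
  have hg0 : 0 ≤ gtc (ν a) 0 := by simp [gtc]
  have p0 := vac_zero A ν a
  have hmul := mul_nonneg (neg_nonneg.2 ha) hg0
  simp only [zero_add, h1, p0] at e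
  have hN0 : N = 0 := by linarith
  have hn' := hn hN0
  obtain ⟨l, r, hl⟩ := exists_sel Prod.snd (ν a)
  obtain ⟨rfl, hl0⟩ := hν.sel_rig hA ha hl
  rcases lt_or_eq_of_le ha with hlt | heq
  · have hg : gtc (ν a) 0 = 0 := by
      rcases lt_or_eq_of_le hg0 with h | h
      · have := mul_pos (neg_pos.2 hlt) h
        linarith
      · exact h.symm
    have hrows := gtc_eq_zero.1 hg
    have := hl0 hlt
    subst this
    refine f_eq_fStar hA hν.ok hl ?_ (by rw [p0]; exact h1) (fun _ => hrows) hn'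
    refine ⟨Or.inl rfl, ?_, ?_⟩
    · rintro q (rfl | hq)
      · exact le_rfl
      · have := hrows q hq
        have := hν.ok.pos a q hq
        omega
    · rintro q (rfl | hq) _
      · exact le_rfl
      · exact hrows q hq
  · have hz := zero_flat hA hν.ok heq h1
    have hrig : ∀ q ∈ ν a, q.2 = 0 := by
      intro q hq
      have e1 := hν.rig a ha q hq
      have e2 := hν.crig a ha q hq
      rw [hz] at e2
      rw [heq] at e1 e2
      simp at e1 e2
      omega
    refine f_eq_fStar hA hν.ok hl ?_ (by rw [hz, hz]) (fun h => absurd heq h)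
      (fun b hb hne q hq => (hn' b hb hne q hq).trans (Nat.zero_le _))
    refine ⟨hl.mem, ?_, ?_⟩
    · rintro q (rfl | hq)
      · simp [cor, hz]
      · simp [cor, hz, hrig q hq]
    · rintro q (rfl | hq) _
      · simp
      · exact hl.len q (Or.inr hq) (hrig q hq)

theorem imag_commute {A : I → I → ℤ} (hA : IsBorcherdsCartan A) {ν : RCraw I} (hν : W A ν)
    {a : I} (ha : A a a ≤ 0) :
    fOp A a (fStar A a ν) = fStar A a (fOp A a ν) ∨
    fOp A a (fStar A a ν) = fStar A a (fStar A a ν) := by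
  obtain ⟨l, r, hl⟩ := exists_sel Prod.snd (ν a)
  obtain ⟨m, s, hm⟩ := exists_sel (cor A ν a) (ν a)
  obtain ⟨rfl, hl0⟩ := hν.sel_rig hA ha hl
  obtain ⟨rfl, hm0⟩ := hν.sel_cor hA ha hm
  obtain ⟨h, e1, e2⟩ := hA.half a
  have p0 := vac_zero A ν a
  rcases lt_or_eq_of_le ha with hlt | heq
  · left
    have := hl0 hlt
    subst this
    have := hm0 hlt
    subst this
    have hp := vac_imag_nonneg hA hν.ok ha (0 + 1)
    refine commute_gen hA hν.ok hl hm (R := ν a) (by simp [rowm]) ?_ ?_ ?_ ?_ <;> omega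
  · by_cases hp1 : vac A ν a 1 = 0
    · right
      apply imag_eq hA (hν.fStar hA a) ha
      rw [fStar_vac hA hν.ok hm, hp1, heq]; simp
    · left
      have hp : ∀ i, 0 < vac A ν a (i + 1) := by
        intro i
        have q1 := vac_imag_nonneg hA hν.ok ha 1
        have q2 : vac A ν a 1 ≤ vac A ν a (i + 1) := vac_imag_monotone hA hν.ok ha (by omega)
        omega
      obtain ⟨R, hR⟩ := decomp2 hl.mem hm.mem (by
        by_contra hcon
        rw [not_or, not_not] at hcon
        obtain ⟨⟨rfl, hv⟩, hl0⟩ := And.imp_left Prod.mk.inj hcon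
        have := hp (l - 1)
        rw [show l - 1 + 1 = l by omega] at this
        omega)
      have hpl := hp l
      have hpm := hp m
      refine commute_gen hA hν.ok hl hm hR ?_ ?_ ?_ ?_ <;> omega

theorem gen_commute {A : I → I → ℤ} (hA : IsBorcherdsCartan A) {ν : RCraw I} (hν : W A ν)
    (a : I) :
    fOp A a (fStar A a ν) = fStar A a (fOp A a ν) ∨
    fOp A a (fStar A a ν) = fStar A a (fStar A a ν) := by
  rcases hA.diag a with h | h
  · exact real_commute hA hν.ok h
  · exact imag_commute hA hν h.1

/-- Dual version. -/
theorem gen_commute' {A : I → I → ℤ} (hA : IsBorcherdsCartan A) {ν : RCraw I} (hν : W A ν)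
    (a : I) :
    fStar A a (fOp A a ν) = fOp A a (fStar A a ν) ∨
    fStar A a (fOp A a ν) = fOp A a (fOp A a ν) := by
  have hok := theta_ok (A := A) hν.ok
  have e : fStar A a (fOp A a ν) = theta A (fOp A a (fStar A a (theta A ν))) := by
    rw [theta_fOp hA (fStar_ok hA hok), theta_fStar hA hok, theta_theta]
  rcases gen_commute hA hν.theta a with h | h
  · left
    rw [e, h, theta_fStar hA (fOp_ok hok), theta_fOp hA hok, theta_theta]
  · right
    rw [e, h, theta_fStar hA (fStar_ok hA hok), theta_fStar hA hok, theta_theta]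

/-- Configurations generated by the star operators. -/
inductive SG (A : I → I → ℤ) : RCraw I → Prop
  | empty : SG A emptyRC
  | step (a : I) (ν : RCraw I) : SG A ν → SG A (fStar A a ν)

/-- Configurations generated by the ordinary operators. -/
inductive FG (A : I → I → ℤ) : RCraw I → Prop
  | empty : FG A emptyRC
  | step (a : I) (ν : RCraw I) : FG A ν → FG A (fOp A a ν)

theorem SG.w {A : I → I → ℤ} (hA : IsBorcherdsCartan A) {ν : RCraw I} (h : SG A ν) : W A ν := by
  induction h with
  | empty => exact W.empty A
  | step a ν _ ih => exact ih.fStar hA a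

theorem FG.w {A : I → I → ℤ} (hA : IsBorcherdsCartan A) {ν : RCraw I} (h : FG A ν) : W A ν := by
  induction h with
  | empty => exact W.empty A
  | step a ν _ ih => exact ih.fOp hA a

theorem vac_empty (A : I → I → ℤ) (a : I) (i : ℕ) : vac A emptyRC a i = 0 := by
  simp [vac, emptyRC]

theorem f_empty {A : I → I → ℤ} (hA : IsBorcherdsCartan A) (a : I) :
    fOp A a emptyRC = fStar A a emptyRC := by
  have h : ∀ g : ℕ × ℤ → ℤ, Sel g ((emptyRC : RCraw I) a) 0 0 := by
    intro g
    refine ⟨Or.inl rfl, ?_, ?_⟩ <;> rintro q (rfl | hq) <;> simp_all [emptyRC]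
  refine f_eq_fStar hA Ok.empty (h _) (h _) ?_ ?_ ?_
  · simp [vac_empty]
  · simp [emptyRC]
  · simp [emptyRC]

theorem SG.fOp {A : I → I → ℤ} (hA : IsBorcherdsCartan A) {ν : RCraw I} (h : SG A ν) (a : I) :
    SG A (fOp A a ν) := by
  induction h with
  | empty => rw [f_empty hA]; exact SG.step a _ SG.empty
  | step b ν hν ih =>
    by_cases hab : a = b
    · subst hab
      rcases gen_commute hA (hν.w hA) a with h | h
      · rw [h]; exact SG.step a _ ih
      · rw [h]; exact SG.step a _ (SG.step a _ hν)
    · rw [commute_ne hA (hν.w hA).ok hab]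
      exact SG.step b _ ih

theorem FG.sg {A : I → I → ℤ} (hA : IsBorcherdsCartan A) {ν : RCraw I} (h : FG A ν) : SG A ν := by
  induction h with
  | empty => exact SG.empty
  | step a ν _ ih => exact ih.fOp hA a

theorem theta_empty (A : I → I → ℤ) : theta A (emptyRC : RCraw I) = emptyRC := by
  funext b
  simp [theta, emptyRC]

theorem SG.theta {A : I → I → ℤ} (hA : IsBorcherdsCartan A) {ν : RCraw I} (h : SG A ν) :
    FG A (theta A ν) := by
  induction h with
  | empty => rw [theta_empty]; exact FG.empty
  | step a ν hν ih => rw [theta_fStar hA (hν.w hA).ok]; exact FG.step a _ ih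

theorem FG.theta {A : I → I → ℤ} (hA : IsBorcherdsCartan A) {ν : RCraw I} (h : FG A ν) :
    SG A (theta A ν) := by
  induction h with
  | empty => rw [theta_empty]; exact SG.empty
  | step a ν hν ih => rw [theta_fOp hA (hν.w hA).ok]; exact SG.step a _ ih

theorem SG.fg {A : I → I → ℤ} (hA : IsBorcherdsCartan A) {ν : RCraw I} (h : SG A ν) : FG A ν := by
  have := ((h.theta hA).sg hA).theta hA
  rwa [theta_theta] at this

/-! ### Invariants and the operators `e` -/

/-- Structural invariants of generated configurations. -/
structure Ivt (A : I → I → ℤ) (ν : RCraw I) : Prop where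
  real : ∀ a, A a a = 2 → ∀ q ∈ ν a, -(q.1 : ℤ) ≤ q.2
  neg : ∀ a, A a a < 0 → ∀ q ∈ ν a, q.1 = 1
  zero : ∀ a, A a a = 0 → (ν a).countP (fun q => q.2 = 0) ≤ 1

theorem Ivt.rest {A : I → I → ℤ} {ν : RCraw I} (hi : Ivt A ν) {a : I} (ha : A a a = 0)
    {k : ℕ} {R : Multiset (ℕ × ℤ)} (hR : ν a = {(k, 0)} + R) : ∀ q ∈ R, q.2 ≠ 0 := by
  have h := hi.zero a ha
  rw [hR, Multiset.countP_add] at h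
  have h1 : ({(k, 0)} : Multiset (ℕ × ℤ)).countP (fun q => q.2 = 0) = 1 := by
    rw [← Multiset.cons_zero, Multiset.countP_cons]; simp
  rw [h1] at h
  have h2 : R.countP (fun q => q.2 = 0) = 0 := by omega
  exact Multiset.countP_eq_zero.1 h2

theorem Ivt.sel_rest {A : I → I → ℤ} {ν : RCraw I} (hi : Ivt A ν) (hok : Ok ν) {a : I}
    (ha : A a a = 0) {l : ℕ} {R : Multiset (ℕ × ℤ)} (hs : Sel Prod.snd (ν a) l 0)
    (hR : ν a = rowm l 0 + R) : ∀ q ∈ R, q.2 ≠ 0 := by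
  by_cases hl : l = 0
  · subst hl
    intro q hq hq0
    have hq' : q ∈ ν a := by rw [hR]; exact Multiset.mem_add.2 (Or.inr hq)
    have h1 := hs.len q (Or.inr hq') hq0
    have h2 := hok.pos a q hq'
    omega
  · apply hi.rest ha (k := l)
    rw [hR, rowm, if_neg hl]

theorem real_bound {A : I → I → ℤ} {ν : RCraw I} {a : I} {l : ℕ} {r : ℤ}
    {R : Multiset (ℕ × ℤ)} (ha : A a a = 2) (hs : Sel Prod.snd (ν a) l r)
    (hR : ν a = rowm l r + R) :
    ∀ q ∈ R.map (sh l (A a a)), r - 1 ≤ q.2 ∧ (q.2 < r → l + 1 ≤ q.1) := by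
  intro q hq
  obtain ⟨q', hq', rfl⟩ := Multiset.mem_map.1 hq
  have hm : VV (ν a) q' := Or.inr (by rw [hR]; exact Multiset.mem_add.2 (Or.inr hq'))
  have e1 : r ≤ q'.2 := hs.le q' hm
  have e2 : q'.2 = r → q'.1 ≤ l := hs.len q' hm
  simp only [sh, ha]
  split_ifs with h
  · have : q'.2 ≠ r := fun h' => by have := e2 h'; omega
    omega
  · omega

theorem Ivt.fOp {A : I → I → ℤ} (hA : IsBorcherdsCartan A) {ν : RCraw I} (hi : Ivt A ν)
    (hν : W A ν) (b : I) : Ivt A (fOp A b ν) := by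
  obtain ⟨l, r, hs⟩ := exists_sel Prod.snd (ν b)
  obtain ⟨R, hR⟩ := hs.mem.decomp
  obtain ⟨f1, f2⟩ := fOp_self A (hν.ok.pos b) hs hR
  have hRs : ∀ q ∈ R, q ∈ ν b := by
    intro q hq; rw [hR]; exact Multiset.mem_add.2 (Or.inr hq)
  have hoff : ∀ c, c ≠ b → ∀ i, (if l < i then A c b else 0) ≤ 0 := by
    intro c hc i
    split_ifs
    · exact hA.offdiag c b hc
    · exact le_rfl
  refine ⟨?_, ?_, ?_⟩
  · intro c hc q hq
    by_cases hcb : c = b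
    · subst hcb
      have hrl : -(l : ℤ) ≤ r := by
        rcases hs.mem with h | h
        · obtain ⟨rfl, rfl⟩ := Prod.mk.inj h; simp
        · exact hi.real c hc (l, r) h
      rw [f1] at hq
      rcases Multiset.mem_add.1 hq with hq | hq
      · have hb := real_bound hc hs hR q hq
        by_cases hlt : q.2 < r
        · have := hb.2 hlt; omega
        · obtain ⟨q', hq', rfl⟩ := Multiset.mem_map.1 hq
          have := hi.real c hc q' (hRs q' hq')
          simp only [sh, hc] at *
          split_ifs at * <;> omega
      · rw [Multiset.mem_singleton.1 hq]
        simp only [hc]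
        push_cast
        omega
    · rw [f2 c hcb] at hq
      obtain ⟨q', hq', rfl⟩ := Multiset.mem_map.1 hq
      have := hi.real c hc q' hq'
      have := hoff c hcb q'.1
      simp only [sh]
      omega
  · intro c hc q hq
    by_cases hcb : c = b
    · subst hcb
      rw [f1] at hq
      rcases Multiset.mem_add.1 hq with hq | hq
      · obtain ⟨q', hq', rfl⟩ := Multiset.mem_map.1 hq
        exact hi.neg c hc q' (hRs q' hq')
      · rw [Multiset.mem_singleton.1 hq]
        have := (hν.sel_rig hA hc.le hs).2 hc
        simp [this]
    · rw [f2 c hcb] at hq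
      obtain ⟨q', hq', rfl⟩ := Multiset.mem_map.1 hq
      exact hi.neg c hc q' hq'
  · intro c hc
    by_cases hcb : c = b
    · subst hcb
      obtain ⟨rfl, _⟩ := hν.sel_rig hA hc.le hs
      have h0 := hi.sel_rest hν.ok hc hs hR
      rw [f1, hc, map_sh_id (by simp), Multiset.countP_add, Multiset.countP_eq_zero.2 h0]
      rw [zero_add, ← Multiset.cons_zero, Multiset.countP_cons]
      simp
    · refine le_trans ?_ (hi.zero c hc)
      rw [f2 c hcb, Multiset.countP_map, Multiset.countP_eq_card_filter]
      apply Multiset.card_le_card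
      apply Multiset.le_filter.2
      refine ⟨Multiset.filter_le _ _, ?_⟩
      intro q hq
      obtain ⟨h1, h2⟩ := Multiset.mem_filter.1 hq
      have h3 := hν.rig c hc.le q h1
      have h4 := hoff c hcb q.1
      rw [hc] at h3
      simp only [sh] at h2
      simp at h3
      omega

theorem FG.inv {A : I → I → ℤ} (hA : IsBorcherdsCartan A) {ν : RCraw I} (h : FG A ν) :
    Ivt A ν := by
  induction h with
  | empty => refine ⟨?_, ?_, ?_⟩ <;> simp [emptyRC]
  | step a ν h ih => exact ih.fOp hA (h.w hA) a

/-- Inverse shift of riggings. -/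
def us (k : ℕ) (K : ℤ) (q : ℕ × ℤ) : ℕ × ℤ := (q.1, q.2 + if k < q.1 then K else 0)

theorem us_sh (k : ℕ) (K : ℤ) (M : Multiset (ℕ × ℤ)) : (M.map (sh k K)).map (us k K) = M := by
  rw [Multiset.map_map]
  conv_rhs => rw [← Multiset.map_id M]
  apply Multiset.map_congr rfl
  intro q _
  by_cases h : k < q.1 <;> simp [us, sh, h]

theorem sh_us (k : ℕ) (K : ℤ) (M : Multiset (ℕ × ℤ)) : (M.map (us k K)).map (sh k K) = M := by
  rw [Multiset.map_map]
  conv_rhs => rw [← Multiset.map_id M]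
  apply Multiset.map_congr rfl
  intro q _
  by_cases h : k < q.1 <;> simp [us, sh, h]

theorem eRemove_self (A : I → I → ℤ) {a : I} {ν : RCraw I} {k : ℕ} {x : ℤ}
    {R : Multiset (ℕ × ℤ)} (hR : ν a = {(k + 1, x)} + R)
    (hmin : ∀ q ∈ ν a, q.2 = x → k + 1 ≤ q.1) :
    eRemove A a ν x a = R.map (us k (A a a)) + rowm k (x + A a a / 2) ∧
    ∀ b, b ≠ a → eRemove A a ν x b = (ν b).map (us k (A b a)) := by
  have hl : minPosRowsN (((ν a).filter fun p => p.2 = x).map Prod.fst) = k + 1 := by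
    apply foldminmax_eq
    · refine Multiset.mem_map.2 ⟨(k + 1, x), ?_, rfl⟩
      rw [Multiset.mem_filter, hR]; simp
    · intro w hw
      obtain ⟨q, hq, rfl⟩ := Multiset.mem_map.1 hw
      obtain ⟨h1, h2⟩ := Multiset.mem_filter.1 hq
      exact hmin q h1 h2
  have hu : ∀ K : ℤ, (fun p : ℕ × ℤ => (p.1, p.2 + if k + 1 ≤ p.1 then K else 0)) = us k K := by
    intro K; rfl
  constructor
  · simp only [eRemove, hl, hu, if_true]
    congr 1
    · rw [hR]; simp
    · unfold rowm
      by_cases hk : k = 0 <;> simp [hk]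
  · intro b hb
    simp only [eRemove, hl, hu, if_neg hb]

theorem exists_short {M : Multiset (ℕ × ℤ)} {x : ℤ} (hpos : ∀ q ∈ M, 0 < q.1)
    (h : ∃ q ∈ M, q.2 = x) :
    ∃ k R, M = {(k + 1, x)} + R ∧ ∀ q ∈ M, q.2 = x → k + 1 ≤ q.1 := by
  obtain ⟨q, hq, hx⟩ := h
  have hne : ((M.filter fun p => p.2 = x).map Prod.fst) ≠ 0 := by
    intro h0
    have : q.1 ∈ ((M.filter fun p => p.2 = x).map Prod.fst) :=
      Multiset.mem_map_of_mem _ (Multiset.mem_filter.2 ⟨hq, hx⟩)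
    rw [h0] at this
    simp at this
  obtain ⟨h1, h2⟩ := foldminmax_mem _ 0 hne
  obtain ⟨p, hp, hp2⟩ := Multiset.mem_map.1 h1
  rw [← hp2] at h2
  obtain ⟨hpM, hpx⟩ := Multiset.mem_filter.1 hp
  obtain ⟨R, hR⟩ := Multiset.exists_cons_of_mem hpM
  have := hpos p hpM
  have ep : p = (p.1 - 1 + 1, x) := by
    apply Prod.ext
    · simp only; omega
    · exact hpx
  refine ⟨p.1 - 1, R, ?_, ?_⟩
  · rw [← ep, hR]; simp
  · intro w hw hwx
    have := h2 w.1 (Multiset.mem_map_of_mem _ (Multiset.mem_filter.2 ⟨hw, hwx⟩))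
    omega

theorem e_f {A : I → I → ℤ} (hA : IsBorcherdsCartan A) {ν : RCraw I} (hi : Ivt A ν)
    (hν : W A ν) (a : I) : eOp A a (fOp A a ν) = some ν ∧
      (A a a = 2 → minWith0 ((fOp A a ν a).map Prod.snd) = minWith0 ((ν a).map Prod.snd) - 1) := by
  obtain ⟨l, r, hs⟩ := exists_sel Prod.snd (ν a)
  obtain ⟨R, hR⟩ := hs.mem.decomp
  obtain ⟨f1, f2⟩ := fOp_self A (hν.ok.pos a) hs hR
  have f1' : fOp A a ν a = {(l + 1, r - A a a / 2)} + R.map (sh l (A a a)) := by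
    rw [f1, add_comm]
  have core : (∀ q ∈ fOp A a ν a, q.2 = r - A a a / 2 → l + 1 ≤ q.1) →
      eRemove A a (fOp A a ν) (r - A a a / 2) = ν := by
    intro hmin
    obtain ⟨g1, g2⟩ := eRemove_self A f1' hmin
    funext b
    by_cases hb : b = a
    · subst hb
      rw [g1, us_sh, hR, add_comm]
      congr 2; ring
    · rw [g2 b hb, f2 b hb, us_sh]
  have hr0 : r ≤ 0 := hs.le (0, 0) (Or.inl rfl)
  have hxν : minWith0 ((ν a).map Prod.snd) = r := by
    apply minWith0_eq _ _ _ hr0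
    · intro w hw
      obtain ⟨q, hq, rfl⟩ := Multiset.mem_map.1 hw
      exact hs.le q (Or.inr hq)
    · rcases hs.mem with h | h
      · left; exact (Prod.mk.inj h).2
      · right; exact Multiset.mem_map.2 ⟨(l, r), h, rfl⟩
  have hmemf : (l + 1, r - A a a / 2) ∈ fOp A a ν a := by rw [f1']; simp
  by_cases ha : A a a = 2
  · have half : A a a / 2 = 1 := by rw [ha]; rfl
    rw [half] at f1' core hmemf
    have hb := real_bound ha hs hR
    have hx : minWith0 ((fOp A a ν a).map Prod.snd) = r - 1 := by
      apply minWith0_eq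
      · right; exact Multiset.mem_map.2 ⟨_, hmemf, rfl⟩
      · omega
      · intro w hw
        obtain ⟨q, hq, rfl⟩ := Multiset.mem_map.1 hw
        rw [f1'] at hq
        rcases Multiset.mem_add.1 hq with hq | hq
        · rw [Multiset.mem_singleton.1 hq]
        · exact (hb q hq).1
    refine ⟨?_, fun _ => by rw [hx, hxν]⟩
    simp only [eOp, if_pos ha, hx]
    rw [if_neg (by omega), core]
    intro q hq hq2
    rw [f1'] at hq
    rcases Multiset.mem_add.1 hq with hq | hq
    · rw [Multiset.mem_singleton.1 hq]
    · exact (hb q hq).2 (by omega)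
  · refine ⟨?_, fun h => absurd h ha⟩
    have hle : A a a ≤ 0 := by
      rcases hA.diag a with h | h
      · exact absurd h ha
      · exact h.1
    obtain ⟨h, h1, h2⟩ := hA.half a
    obtain ⟨rfl, hl0⟩ := hν.sel_rig hA hle hs
    have hneg : -A a a / 2 = 0 - A a a / 2 := by omega
    have hne : fOp A a ν a ≠ 0 := by
      intro h0; rw [h0] at hmemf; simp at hmemf
    have hmin : minPosRows ((fOp A a ν a).map Prod.snd) = -A a a / 2 := by
      apply foldminmax_eq
      · rw [hneg]; exact Multiset.mem_map.2 ⟨_, hmemf, rfl⟩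
      · intro w hw
        obtain ⟨q, hq, rfl⟩ := Multiset.mem_map.1 hw
        have := (hν.fOp hA a).rig a hle q hq
        omega
    simp only [eOp, if_neg ha]
    rw [if_neg (by rw [not_or]; exact ⟨hne, not_not.2 hmin⟩), hneg, core]
    intro q hq hq2
    rcases lt_or_eq_of_le hle with hlt | heq
    · have := hl0 hlt
      have := (fOp_ok (A := A) (a := a) hν.ok).pos a q hq
      omega
    · rw [f1'] at hq
      rcases Multiset.mem_add.1 hq with hq | hq
      · rw [Multiset.mem_singleton.1 hq]
      · rw [heq, map_sh_id (by simp)] at hq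
        rw [heq] at hq2
        exact absurd hq2 (hi.sel_rest hν.ok heq hs hR q hq)

/-- When `e` is defined: the value of the minimal rigging. -/
theorem eOp_some {A : I → I → ℤ} (hA : IsBorcherdsCartan A) {ν μ : RCraw I} {a : I}
    (h : eOp A a ν = some μ) : ∃ x, μ = eRemove A a ν x ∧ (∃ q ∈ ν a, q.2 = x) ∧
      (∀ q ∈ ν a, x ≤ q.2) ∧ (A a a = 2 → x < 0) ∧ (A a a ≤ 0 → x = -(A a a / 2)) := by
  by_cases ha : A a a = 2
  · simp only [eOp, if_pos ha] at h
    split_ifs at h with h0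
    obtain ⟨⟨s1, s2⟩, s3⟩ := minWith0_spec ((ν a).map Prod.snd)
    refine ⟨_, (Option.some.inj h).symm, ?_, ?_, fun _ => by omega, fun h => by omega⟩
    · rcases s3 with s3 | s3
      · exact absurd s3 h0
      · obtain ⟨q, hq, e⟩ := Multiset.mem_map.1 s3
        exact ⟨q, hq, e⟩
    · intro q hq
      exact s2 _ (Multiset.mem_map_of_mem _ hq)
  · simp only [eOp, if_neg ha] at h
    split_ifs at h with h0
    rw [not_or, not_not] at h0
    obtain ⟨h1, h2⟩ := h0
    obtain ⟨s1, s2⟩ := foldminmax_mem ((ν a).map Prod.snd) 0 (by simpa using h1)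
    change minPosRows _ ∈ _ at s1
    change ∀ w ∈ _, minPosRows _ ≤ w at s2
    rw [h2] at s1 s2
    obtain ⟨k, e1, e2⟩ := hA.half a
    refine ⟨_, (Option.some.inj h).symm, ?_, ?_, fun h => absurd h ha, fun _ => by omega⟩
    · obtain ⟨q, hq, e⟩ := Multiset.mem_map.1 s1
      exact ⟨q, hq, e⟩
    · intro q hq
      exact s2 _ (Multiset.mem_map_of_mem _ hq)

theorem f_e {A : I → I → ℤ} (hA : IsBorcherdsCartan A) {ν μ : RCraw I} (hi : Ivt A ν)
    (hν : W A ν) (hμ : W A μ) {a : I} (h : eOp A a ν = some μ) : fOp A a μ = ν := by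
  obtain ⟨x, rfl, hex, hxle, hxr, hxi⟩ := eOp_some hA h
  obtain ⟨k, R, hR, hmin⟩ := exists_short (hν.ok.pos a) hex
  obtain ⟨g1, g2⟩ := eRemove_self A hR hmin
  have g1' : eRemove A a ν x a = rowm k (x + A a a / 2) + R.map (us k (A a a)) := by
    rw [g1, add_comm]
  have hRs : ∀ q ∈ R, q ∈ ν a := by
    intro q hq; rw [hR]; exact Multiset.mem_add.2 (Or.inr hq)
  have hk1 : (k + 1, x) ∈ ν a := by rw [hR]; simp
  have hsel : Sel Prod.snd (eRemove A a ν x a) k (x + A a a / 2) := by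
    have hmemk : k ≠ 0 → VV (eRemove A a ν x a) (k, x + A a a / 2) := by
      intro hk
      right; rw [g1']
      exact Multiset.mem_add.2 (Or.inl (mem_rowm.2 ⟨hk, rfl⟩))
    rcases hA.diag a with ha | ⟨ha, _⟩
    · have half : A a a / 2 = 1 := by rw [ha]; rfl
      have hx0 := hxr ha
      rw [half] at g1' hmemk ⊢
      refine ⟨?_, ?_, ?_⟩
      · by_cases hk : k = 0
        · subst hk
          left
          have : -((0 + 1 : ℕ) : ℤ) ≤ x := hi.real a ha (0 + 1, x) hk1
          push_cast at this
          congr 1; omega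
        · exact hmemk hk
      · rintro q (rfl | hq)
        · simp only; omega
        · rw [g1'] at hq
          rcases Multiset.mem_add.1 hq with hq | hq
          · rw [(mem_rowm.1 hq).2]
          · obtain ⟨q', hq', rfl⟩ := Multiset.mem_map.1 hq
            have e1 := hxle q' (hRs q' hq')
            have e2 := hmin q' (hRs q' hq')
            simp only [us, ha]
            split_ifs with hlt
            · omega
            · have : q'.2 ≠ x := fun h => by have := e2 h; omega
              omega
      · rintro q (rfl | hq) he
        · simp
        · rw [g1'] at hq
          rcases Multiset.mem_add.1 hq with hq | hq
          · rw [(mem_rowm.1 hq).2]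
          · obtain ⟨q', hq', rfl⟩ := Multiset.mem_map.1 hq
            have e1 := hxle q' (hRs q' hq')
            simp only [us, ha] at *
            split_ifs at he with hlt
            · omega
            · omega
    · have hx := hxi ha
      have hxh : x + A a a / 2 = 0 := by omega
      obtain ⟨h, e1, e2⟩ := hA.half a
      rw [hxh] at g1' hmemk ⊢
      rcases lt_or_eq_of_le ha with hlt | heq
      · have hk0 : k + 1 = 1 := hi.neg a hlt (k + 1, x) hk1
        have hk0 : k = 0 := by omega
        subst hk0
        refine ⟨Or.inl rfl, ?_, ?_⟩
        · rintro q (rfl | hq)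
          · exact le_rfl
          · have := hμ.rig a ha q hq
            simp only; omega
        · rintro q (rfl | hq) he
          · simp
          · have := hμ.rig a ha q hq
            simp only at he; omega
      · have hx0 : x = 0 := by omega
        subst hx0
        have hrest := hi.rest heq hR
        refine ⟨?_, ?_, ?_⟩
        · by_cases hk : k = 0
          · left; rw [hk]
          · exact hmemk hk
        · rintro q (rfl | hq)
          · exact le_rfl
          · have := hμ.rig a ha q hq
            simp only; omega
        · rintro q (rfl | hq) he
          · simp
          · rw [g1'] at hq
            rcases Multiset.mem_add.1 hq with hq | hq
            · rw [(mem_rowm.1 hq).2]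
            · obtain ⟨q', hq', rfl⟩ := Multiset.mem_map.1 hq
              have := hrest q' hq'
              simp [us, heq] at he
              exact absurd he this
  obtain ⟨f1, f2⟩ := fOp_self A (hμ.ok.pos a) hsel g1'
  funext b
  by_cases hb : b = a
  · subst hb
    rw [f1, sh_us, hR, add_comm]
    congr 3; ring
  · rw [f2 b hb, g2 b hb, sh_us]

/-! ### Closure under `e` and the conclusion -/

theorem eOp_none_congr {A : I → I → ℤ} {ν ν' : RCraw I} {a : I} (h : ν a = ν' a)
    (hn : eOp A a ν' = none) : eOp A a ν = none := by
  simp only [eOp, h] at *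
  split_ifs at * <;> simp_all

theorem eOp_none_real {A : I → I → ℤ} {ν : RCraw I} {a : I} (ha : A a a = 2)
    (hn : eOp A a ν = none) : ∀ q ∈ ν a, 0 ≤ q.2 := by
  simp only [eOp, if_pos ha] at hn
  split_ifs at hn with h0
  intro q hq
  have := (minWith0_spec ((ν a).map Prod.snd)).1.2 _ (Multiset.mem_map_of_mem _ hq)
  omega

theorem eOp_none_imag {A : I → I → ℤ} (hA : IsBorcherdsCartan A) {ν : RCraw I} (hν : W A ν)
    {a : I} (ha : A a a ≤ 0) (hn : eOp A a ν = none) : ∀ q ∈ ν a, q.2 ≠ -(A a a / 2) := by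
  obtain ⟨h, h1, h2⟩ := hA.half a
  intro q hq hx
  simp only [eOp] at hn
  rw [if_neg (by omega)] at hn
  have hmin : minPosRows ((ν a).map Prod.snd) = -A a a / 2 := by
    apply foldminmax_eq
    · exact Multiset.mem_map.2 ⟨q, hq, by omega⟩
    · intro w hw
      obtain ⟨p, hp, rfl⟩ := Multiset.mem_map.1 hw
      have := hν.rig a ha p hp
      omega
  rw [if_neg] at hn
  · simp at hn
  · rw [not_or, not_not]
    refine ⟨?_, hmin⟩
    intro h0
    rw [h0] at hq
    simp at hq

theorem none_eq {A : I → I → ℤ} (hA : IsBorcherdsCartan A) {ν μ : RCraw I} (hν : W A ν)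
    {a : I} (hn : eOp A a ν = none) (h : eOp A a (fStar A a ν) = some μ) :
    fStar A a ν = fOp A a ν := by
  obtain ⟨m, s, hm⟩ := exists_sel (cor A ν a) (ν a)
  obtain ⟨T, hT⟩ := hm.mem.decomp
  obtain ⟨g1, g2⟩ := fStar_self hA (hν.ok.pos a) hm hT
  have hTs : ∀ q ∈ T, q ∈ ν a := by
    intro q hq; rw [hT]; exact Multiset.mem_add.2 (Or.inr hq)
  obtain ⟨x, -, ⟨q, hq, hqx⟩, -, hxr, hxi⟩ := eOp_some hA h
  rw [g1] at hq
  rcases hA.diag a with ha | ⟨ha, _⟩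
  · have h0 := eOp_none_real ha hn
    have hx := hxr ha
    obtain ⟨l, r, hl⟩ := exists_sel Prod.snd (ν a)
    have hr : 0 ≤ r := by
      rcases hl.mem with h | h
      · rw [(Prod.mk.inj h).2]
      · exact h0 (l, r) h
    rcases Multiset.mem_add.1 hq with hq | hq
    · have := h0 q (hTs q hq)
      omega
    · rw [Multiset.mem_singleton.1 hq, ha] at hqx
      simp only at hqx
      exact (real_eq hA hν.ok hl hm (by omega)).symm
  · have h0 := eOp_none_imag hA hν ha hn
    have hx := hxi ha
    rcases Multiset.mem_add.1 hq with hq | hq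
    · exact absurd (hqx.trans hx) (h0 q (hTs q hq))
    · rw [Multiset.mem_singleton.1 hq] at hqx
      simp only at hqx
      have hs := (hν.sel_cor hA ha hm).1
      have h1 : vac A ν a 1 ≤ vac A ν a (m + 1) := vac_imag_monotone hA hν.ok ha (by omega)
      have h2 := vac_imag_nonneg hA hν.ok ha 1
      exact (imag_eq hA hν ha (by omega)).symm

theorem SG.e {A : I → I → ℤ} (hA : IsBorcherdsCartan A) {ν : RCraw I} (h : SG A ν) :
    ∀ (a : I) (μ : RCraw I), eOp A a ν = some μ → SG A μ := by
  induction h with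
  | empty =>
    intro a μ h
    obtain ⟨x, -, ⟨q, hq, -⟩, -⟩ := eOp_some hA h
    simp [emptyRC] at hq
  | step b ν hν ih =>
    intro a μ h
    have hW := hν.w hA
    have hI := (hν.fg hA).inv hA
    have fin : ∀ κ, SG A κ → fStar A b ν = _root_.fOp A a κ → SG A μ := by
      intro κ hκ e
      rw [e, (e_f hA ((hκ.fg hA).inv hA) (hκ.w hA) a).1] at h
      rw [← Option.some.inj h]
      exact hκ
    cases hc : eOp A a ν with
    | none =>
      by_cases hab : a = b
      · subst hab
        exact fin ν hν (none_eq hA hW hc h)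
      · obtain ⟨m, s, hm⟩ := exists_sel (cor A ν b) (ν b)
        obtain ⟨T, hT⟩ := hm.mem.decomp
        obtain ⟨g1, g2⟩ := fStar_self hA (hW.ok.pos b) hm hT
        have := eOp_none_congr (A := A) (g2 a hab) hc
        rw [this] at h
        simp at h
    | some κ =>
      have hκ := ih a κ hc
      have e := f_e hA hI hW (hκ.w hA) hc
      by_cases hab : a = b
      · subst hab
        rcases gen_commute' hA (hκ.w hA) a with h1 | h1
        · exact fin _ (SG.step a _ hκ) (by rw [← e, h1])
        · exact fin _ (hκ.fOp hA a) (by rw [← e, h1, e])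
      · exact fin _ (SG.step b _ hκ) (by rw [commute_ne hA (hκ.w hA).ok hab, e])

theorem RCinf.sg {A : I → I → ℤ} (hA : IsBorcherdsCartan A) {ν : RCraw I} (h : RCinf A ν) :
    SG A ν := by
  induction h with
  | empty => exact SG.empty
  | fstep a ν _ ih => exact ih.fOp hA a
  | estep a ν ν' _ h ih => exact ih.e hA a ν' h

theorem iterOpt_succ {α : Type*} (g : α → Option α) (k : ℕ) (v : α) :
    iterOpt g (k + 1) v = (g v).bind (iterOpt g k) := by
  induction k generalizing v with
  | zero => simp [iterOpt]
  | succ k ih =>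
    have e : iterOpt g (k + 1 + 1) v = (iterOpt g (k + 1) v).bind g := rfl
    rw [e, ih, Option.bind_assoc]
    rfl

theorem iter_iff {A : I → I → ℤ} (hA : IsBorcherdsCartan A) {a : I} (ha : A a a = 2) (n : ℕ) :
    ∀ ν : RCraw I, SG A ν → minWith0 ((ν a).map Prod.snd) = -(n : ℤ) →
      ∀ k, iterOpt (eOp A a) k ν ≠ none ↔ k ≤ n := by
  induction n with
  | zero =>
    intro ν _ hx k
    cases k with
    | zero => simp [iterOpt]
    | succ k =>
      have hn : eOp A a ν = none := by
        simp only [eOp, if_pos ha]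
        rw [if_pos (by simpa using hx)]
      rw [iterOpt_succ, hn]
      simp
  | succ n ih =>
    intro ν hν hx k
    cases k with
    | zero => simp [iterOpt]
    | succ k =>
      obtain ⟨μ, hμ⟩ : ∃ μ, eOp A a ν = some μ := by
        refine ⟨eRemove A a ν (minWith0 ((ν a).map Prod.snd)), ?_⟩
        simp only [eOp, if_pos ha]
        rw [if_neg (by rw [hx]; push_cast; omega)]
      have hS := hν.e hA a μ hμ
      have e := f_e hA ((hν.fg hA).inv hA) (hν.w hA) (hS.w hA) hμ
      have e2 := (e_f hA ((hS.fg hA).inv hA) (hS.w hA) a).2 ha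
      rw [e, hx] at e2
      have := ih μ hS (by push_cast at e2; omega) k
      rw [iterOpt_succ, hμ, Option.bind_some, this]
      omega

/-- Final form. -/
theorem eps_eq {A : I → I → ℤ} (hA : IsBorcherdsCartan A) {ν : RCraw I} (h : RCinf A ν) (a : I) :
    epsRC A a ν = -minWith0 ((ν a).map Prod.snd) := by
  have hS := h.sg hA
  have hle := (minWith0_spec ((ν a).map Prod.snd)).1.1
  unfold epsRC
  split_ifs with ha
  · obtain ⟨n, hn⟩ : ∃ n : ℕ, minWith0 ((ν a).map Prod.snd) = -(n : ℤ) :=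
      ⟨(-minWith0 ((ν a).map Prod.snd)).toNat, by omega⟩
    have hset : {k | iterOpt (eOp A a) k ν ≠ none} = Set.Iic n := by
      ext k
      exact iter_iff hA ha n ν hS hn k
    rw [hn, teRC, hset, csSup_Iic]
    ring
  · have ha' : A a a ≤ 0 := by
      rcases hA.diag a with h | h
      · exact absurd h ha
      · exact h.1
    have : minWith0 ((ν a).map Prod.snd) = 0 := by
      apply minWith0_eq _ _ (Or.inl rfl) le_rfl
      intro w hw
      obtain ⟨q, hq, rfl⟩ := Multiset.mem_map.1 hw
      have := (hS.w hA).rig a ha' q hq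
      omega
    rw [this]; simp

/-- For `(ν,J) ∈ RC(∞)` and `a ∈ I`, with `x ≤ 0` the smallest rigging of `(ν,J)^(a)`
(the length-`0` rows of rigging `0` included): `ε_a(ν,J) = -x` and
`φ_a(ν,J) = p_∞^(a) - x`. -/
theorem rc_eps_phi {I : Type*} [DecidableEq I] (A : I → I → ℤ)
    (hA : IsBorcherdsCartan A) :
    ∀ ν : RCraw I, RCinf A ν → ∀ a : I,
      minWith0 ((ν a).map Prod.snd) ≤ 0 ∧
      epsRC A a ν = -minWith0 ((ν a).map Prod.snd) ∧
      phiRC A a ν = pInf A ν a - minWith0 ((ν a).map Prod.snd) := by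
  intro ν h a
  have e := eps_eq hA h a
  refine ⟨(minWith0_spec ((ν a).map Prod.snd)).1.1, e, ?_⟩
  unfold phiRC
  rw [e]
  ring
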